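/- arXiv:2001.08039 — 2 statements merged into one kernel-verified Lean document; each statement's English description precedes it below -/
import Mathlib

section
/- There exists a_l > 0 such that for every a ∈ (0, a_l) there exists ε₀ > 0 such that for every ε ∈ (0, ε₀) the regularized linear switching equation ε·v′(x) = −a·ε·v(x) − [1 + (1 + ψ(v(x)))·cos(πx)]·sin(πx/2) has a solution v_p : ℝ → ℝ with v_p(x + 4) = v_p(x) for all x (a 4-periodic solution), and v_p is locally asymptotically stable: there exists δ > 0 such that every solution v with |v(x₀) − v_p(x₀)| < δ for some x₀ is defined for all x ≥ x₀ and satisfies |v(x) − v_p(x)| → 0 as x → +∞. -/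
open Real Set

/-- The forcing term of the switching equation when the regularized sign takes the value `u`. -/
noncomputable def forcing (x u : ℝ) : ℝ :=
  (1 + (1 + u) * Real.cos (π * x)) * Real.sin (π * x / 2)

/-- The properties of a transition function used below. -/
structure IsTransition (ψ : ℝ → ℝ) (M : ℝ) : Prop where
  hasDerivAt : ∀ u, HasDerivAt ψ (deriv ψ u) u
  monotone : Monotone ψ
  abs_le_one : ∀ u, |ψ u| ≤ 1
  eq_one : ∀ u, 1 ≤ u → ψ u = 1
  eq_neg_one : ∀ u, u ≤ -1 → ψ u = -1
  deriv_eq_zero : ∀ u, 1 ≤ |u| → deriv ψ u = 0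
  abs_deriv_le : ∀ u, |deriv ψ u| ≤ M
  continuous_deriv : Continuous (deriv ψ)
  uniformContinuous_deriv : UniformContinuous (deriv ψ)

theorem exists_isTransition {ψ : ℝ → ℝ} (hψ : ContDiff ℝ 1 ψ)
    (hψ' : ∀ u : ℝ, |u| < 1 → 0 < deriv ψ u)
    (hψs : ∀ u : ℝ, 1 ≤ |u| → ψ u = Real.sign u) : ∃ M, IsTransition ψ M := by
  have hd : Differentiable ℝ ψ := hψ.differentiable (by norm_num)
  have hc : Continuous (deriv ψ) := hψ.continuous_deriv (by norm_num)
  have e1 : ∀ u, 1 ≤ u → ψ u = 1 := fun u hu => by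
    rw [hψs u (hu.trans (le_abs_self u)), Real.sign_of_pos (by linarith)]
  have e2 : ∀ u, u ≤ -1 → ψ u = -1 := fun u hu => by
    rw [hψs u (by rw [abs_of_neg (by linarith)]; linarith), Real.sign_of_neg (by linarith)]
  have mono : MonotoneOn ψ (Icc (-1) 1) :=
    (strictMonoOn_of_deriv_pos (convex_Icc _ _) hd.continuous.continuousOn (by
      intro x hx
      rw [interior_Icc] at hx
      exact hψ' x (abs_lt.2 hx))).monotoneOn
  have b1 : ∀ u, |ψ u| ≤ 1 := by
    intro u
    rcases le_total 1 u with h | h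
    · simp [e1 u h]
    rcases le_total u (-1) with h' | h'
    · simp [e2 u h']
    · rw [abs_le]
      constructor
      · rw [← e2 (-1) le_rfl]; exact mono (by simp) ⟨h', h⟩ h'
      · rw [← e1 1 le_rfl]; exact mono ⟨h', h⟩ (by simp) h
  have d0 : ∀ u, 1 ≤ |u| → deriv ψ u = 0 := by
    intro u hu
    rcases le_abs.1 hu with h | h
    · apply IsLocalMax.deriv_eq_zero
      exact Filter.Eventually.of_forall fun w => by
        rw [e1 u h]; exact (abs_le.1 (b1 w)).2
    · apply IsLocalMin.deriv_eq_zero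
      exact Filter.Eventually.of_forall fun w => by
        rw [e2 u (by linarith)]; exact (abs_le.1 (b1 w)).1
  have hmono : Monotone ψ := monotone_of_deriv_nonneg hd fun u => by
    rcases lt_or_ge |u| 1 with h | h
    · exact (hψ' u h).le
    · exact (d0 u h).ge
  have hcs : HasCompactSupport (deriv ψ) := by
    apply HasCompactSupport.intro (isCompact_Icc (a := (-1 : ℝ)) (b := 1))
    intro u hu
    apply d0
    by_contra h
    exact hu (abs_le.1 (not_le.1 h).le)
  obtain ⟨M, hM⟩ := hc.bounded_above_of_compact_support hcs
  exact ⟨M, fun u => (hd u).hasDerivAt, hmono, b1, e1, e2, d0, hM, hc,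
    hcs.uniformContinuous_of_continuous hc⟩

theorem IsTransition.bound_nonneg {ψ : ℝ → ℝ} {M : ℝ} (hψ : IsTransition ψ M) : 0 ≤ M :=
  (abs_nonneg _).trans (hψ.abs_deriv_le 0)

theorem IsTransition.abs_mul_deriv_le {ψ : ℝ → ℝ} {M : ℝ} (hψ : IsTransition ψ M) (u : ℝ) :
    |u * deriv ψ u| ≤ M := by
  rcases le_total 1 |u| with h | h
  · simp [hψ.deriv_eq_zero u h, hψ.bound_nonneg]
  · rw [abs_mul]
    nlinarith [hψ.abs_deriv_le u, abs_nonneg u, abs_nonneg (deriv ψ u)]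

theorem IsTransition.abs_sub_le {ψ : ℝ → ℝ} {M : ℝ} (hψ : IsTransition ψ M) (u w : ℝ) :
    |ψ u - ψ w| ≤ M * |u - w| := by
  have := Convex.norm_image_sub_le_of_norm_hasDerivWithin_le (f := ψ) (f' := deriv ψ)
    (s := univ) (x := w) (y := u) (C := M) (fun x _ => (hψ.hasDerivAt x).hasDerivWithinAt)
    (fun x _ => hψ.abs_deriv_le x) convex_univ (mem_univ _) (mem_univ _)
  simpa using this

theorem le_of_deriv_lt_of_eq {f f' B B' : ℝ → ℝ} {p q : ℝ}
    (hf : ∀ x ∈ Icc p q, HasDerivAt f (f' x) x) (hB : ∀ x ∈ Icc p q, HasDerivAt B (B' x) x)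
    (h0 : f p ≤ B p) (bound : ∀ x ∈ Icc p q, f x = B x → f' x < B' x) :
    ∀ x ∈ Icc p q, f x ≤ B x := by
  intro x hx
  exact image_le_of_deriv_right_lt_deriv_boundary'
    (fun x hx => (hf x hx).continuousAt.continuousWithinAt)
    (fun x hx => (hf x (Ico_subset_Icc_self hx)).hasDerivWithinAt) h0
    (fun x hx => (hB x hx).continuousAt.continuousWithinAt)
    (fun x hx => (hB x (Ico_subset_Icc_self hx)).hasDerivWithinAt)
    (fun x hx => bound x (Ico_subset_Icc_self hx)) hx

theorem le_of_deriv_le {f f' B B' : ℝ → ℝ} {p q : ℝ}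
    (hf : ∀ x ∈ Icc p q, HasDerivAt f (f' x) x) (hB : ∀ x ∈ Icc p q, HasDerivAt B (B' x) x)
    (h0 : f p ≤ B p) (bound : ∀ x ∈ Icc p q, f' x ≤ B' x) :
    ∀ x ∈ Icc p q, f x ≤ B x := by
  intro x hx
  exact image_le_of_deriv_right_le_deriv_boundary
    (fun x hx => (hf x hx).continuousAt.continuousWithinAt)
    (fun x hx => (hf x (Ico_subset_Icc_self hx)).hasDerivWithinAt) h0
    (fun x hx => (hB x hx).continuousAt.continuousWithinAt)
    (fun x hx => (hB x (Ico_subset_Icc_self hx)).hasDerivWithinAt)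
    (fun x hx => bound x (Ico_subset_Icc_self hx)) hx

theorem sub_le_mul_of_deriv_le {f f' : ℝ → ℝ} {p q C : ℝ} (hpq : p ≤ q)
    (hf : ∀ x ∈ Icc p q, HasDerivAt f (f' x) x) (bound : ∀ x ∈ Icc p q, f' x ≤ C) :
    f q - f p ≤ C * (q - p) := by
  have := le_of_deriv_le (B := fun x => f p + C * (x - p)) (B' := fun _ => C) hf
    (fun x _ => by simpa using (((hasDerivAt_id x).sub_const p).const_mul C).const_add (f p))
    (by simp) bound q ⟨hpq, le_rfl⟩
  linarith

theorem mul_le_sub_of_le_deriv {f f' : ℝ → ℝ} {p q C : ℝ} (hpq : p ≤ q)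
    (hf : ∀ x ∈ Icc p q, HasDerivAt f (f' x) x) (bound : ∀ x ∈ Icc p q, C ≤ f' x) :
    C * (q - p) ≤ f q - f p := by
  have := sub_le_mul_of_deriv_le (f := fun x => -f x) (f' := fun x => -f' x) (C := -C) hpq
    (fun x hx => (hf x hx).neg) (fun x hx => neg_le_neg (bound x hx))
  linarith

theorem exists_first_hit {y : ℝ → ℝ} {X c : ℝ} (hX : 0 ≤ X) (hy : ContinuousOn y (Icc 0 X))
    (h0 : c < y 0) (hX' : y X ≤ c) :
    ∃ p ∈ Icc 0 X, y p = c ∧ ∀ x ∈ Icc 0 p, c ≤ y x := by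
  have hcpt : IsCompact (Icc 0 X ∩ y ⁻¹' Iic c) :=
    isCompact_Icc.of_isClosed_subset (hy.preimage_isClosed_of_isClosed isClosed_Icc isClosed_Iic)
      inter_subset_left
  obtain ⟨p, ⟨hp, hpc⟩, hmin⟩ := hcpt.exists_isLeast ⟨X, ⟨hX, le_rfl⟩, hX'⟩
  have hlt : ∀ x ∈ Ico 0 p, c < y x := by
    intro x hx
    by_contra h
    exact absurd (hmin ⟨⟨hx.1, hx.2.le.trans hp.2⟩, not_lt.1 h⟩) (not_le.2 hx.2)
  have hpc' : y p = c := by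
    refine le_antisymm hpc ?_
    have hp0 : 0 < p := by
      rcases hp.1.eq_or_lt with h | h
      · subst h; exact absurd hpc (not_le.2 h0)
      · exact h
    have htend : Filter.Tendsto y (nhdsWithin p (Ico 0 p)) (nhds (y p)) :=
      (hy p hp).mono (fun x hx => ⟨hx.1, hx.2.le.trans hp.2⟩)
    have : (nhdsWithin p (Ico 0 p)).NeBot := by
      rw [← mem_closure_iff_nhdsWithin_neBot, closure_Ico hp0.ne]
      exact ⟨hp.1, le_rfl⟩
    exact ge_of_tendsto htend (eventually_nhdsWithin_of_forall fun x hx => (hlt x hx).le)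
  refine ⟨p, hp, hpc', fun x hx => ?_⟩
  rcases hx.2.eq_or_lt with h | h
  · rw [h, hpc']
  · exact (hlt x ⟨hx.1, h⟩).le

theorem forcing_eq (x u : ℝ) :
    forcing x u = (1 - u) / 2 * sin (π * x / 2) + (1 + u) / 2 * sin (3 * π * x / 2) := by
  have h3 : sin (3 * π * x / 2) = sin (π * x / 2) + 2 * cos (π * x) * sin (π * x / 2) := by
    rw [show 3 * π * x / 2 = 3 * (π * x / 2) by ring, sin_three_mul,
      show cos (π * x) = cos (2 * (π * x / 2)) by ring_nf, cos_two_mul]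
    linear_combination -4 * sin (π * x / 2) * sin_sq_add_cos_sq (π * x / 2)
  rw [h3, forcing]
  ring

theorem forcing_one (x : ℝ) : forcing x 1 = sin (3 * π * x / 2) := by
  rw [forcing_eq]; norm_num

theorem forcing_neg_one (x : ℝ) : forcing x (-1) = sin (π * x / 2) := by
  rw [forcing_eq]; norm_num

theorem forcing_neg (x u : ℝ) : forcing (-x) u = -forcing x u := by
  simp only [forcing, mul_neg, neg_div, sin_neg, cos_neg]

theorem forcing_add_four (x u : ℝ) : forcing (x + 4) u = forcing x u := by
  simp only [forcing]
  rw [show π * (x + 4) = π * x + 2 * π + 2 * π by ring,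
    show (π * x + 2 * π + 2 * π) / 2 = π * x / 2 + 2 * π by ring,
    cos_add_two_pi, cos_add_two_pi, sin_add_two_pi]

theorem abs_forcing_le {u : ℝ} (x : ℝ) (hu : |u| ≤ 1) : |forcing x u| ≤ 1 := by
  obtain ⟨h1, h2⟩ := abs_le.1 hu
  rw [forcing_eq, abs_le]
  have a1 := neg_one_le_sin (π * x / 2)
  have a2 := sin_le_one (π * x / 2)
  have b1 := neg_one_le_sin (3 * π * x / 2)
  have b2 := sin_le_one (3 * π * x / 2)
  constructor <;> nlinarith

theorem le_forcing {x u k : ℝ} (hu : |u| ≤ 1) (h1 : k ≤ sin (π * x / 2))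
    (h3 : k ≤ sin (3 * π * x / 2)) : k ≤ forcing x u := by
  obtain ⟨h, h'⟩ := abs_le.1 hu
  rw [forcing_eq]
  nlinarith

theorem forcing_sub (x u w : ℝ) :
    forcing x u - forcing x w = cos (π * x) * sin (π * x / 2) * (u - w) := by
  simp only [forcing]; ring

theorem continuous_forcing (u : ℝ) : Continuous fun x => forcing x u := by
  unfold forcing; fun_prop

theorem abs_cos_mul_sin_le (x y : ℝ) : |cos x * sin y| ≤ 1 := by
  rw [abs_mul]
  exact mul_le_one₀ (abs_cos_le_one _) (abs_nonneg _) (abs_sin_le_one _)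

theorem exists_flow {ψ : ℝ → ℝ} {M : ℝ} (hψ : IsTransition ψ M) {a ε : ℝ} (ha : 0 ≤ a)
    (ha' : a ≤ 1 / 8) (hε : 0 < ε) :
    ∃ Y : ℝ → ℝ → ℝ,
      (∀ c ∈ Icc (-1 : ℝ) 1, Y c 0 = c ∧ ∀ x ∈ Icc (-2 : ℝ) 2,
        HasDerivAt (Y c) (-(a * Y c x) - forcing x (ψ (Y c x / ε))) x) ∧
      ∀ x ∈ Icc (-2 : ℝ) 2, ContinuousOn (fun c => Y c x) (Icc (-1) 1) := by
  have hM := hψ.bound_nonneg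
  have hPL : IsPicardLindelof (fun x y => -(a * y) - forcing x (ψ (y / ε)))
      (tmin := -3) (tmax := 3) ⟨0, by norm_num⟩ (0 : ℝ) 10 1 3
      ⟨a + M / ε, by positivity⟩ := by
    constructor
    · intro t _
      apply LipschitzWith.lipschitzOnWith
      apply LipschitzWith.of_dist_le_mul
      intro y z
      simp only [Real.dist_eq]
      have e : -(a * y) - forcing t (ψ (y / ε)) - (-(a * z) - forcing t (ψ (z / ε)))
          = -(a * (y - z)) - cos (π * t) * sin (π * t / 2) * (ψ (y / ε) - ψ (z / ε)) := by
        rw [← forcing_sub]; ring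
      rw [e]
      have h1 := hψ.abs_sub_le (y / ε) (z / ε)
      rw [← sub_div, abs_div, abs_of_pos hε] at h1
      have h2 := abs_cos_mul_sin_le (π * t) (π * t / 2)
      calc _ ≤ |-(a * (y - z))| + |cos (π * t) * sin (π * t / 2) * (ψ (y / ε) - ψ (z / ε))| :=
            abs_sub _ _
        _ ≤ a * |y - z| + 1 * (M * (|y - z| / ε)) := by
            rw [abs_neg, abs_mul, abs_of_nonneg ha, abs_mul (cos _ * _)]
            gcongr
        _ = (a + M / ε) * |y - z| := by ring
    · intro y _
      exact (continuous_const.sub (continuous_forcing _)).continuousOn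
    · intro t _ y hy
      rw [mem_closedBall_zero_iff, Real.norm_eq_abs] at hy
      rw [Real.norm_eq_abs]
      have h2 := abs_forcing_le t (hψ.abs_le_one (y / ε))
      calc _ ≤ |-(a * y)| + |forcing t (ψ (y / ε))| := abs_sub _ _
        _ ≤ 1 / 8 * 10 + 1 := by
            rw [abs_neg, abs_mul, abs_of_nonneg ha]
            gcongr
            simpa using hy
        _ ≤ _ := by norm_num
    · norm_num
  obtain ⟨Y, hY, L, hL⟩ := hPL.exists_forall_mem_closedBall_eq_hasDerivWithinAt_lipschitzOnWith
  have hball : Metric.closedBall (0 : ℝ) ((1 : NNReal) : ℝ) = Icc (-1) 1 := by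
    rw [Real.closedBall_eq_Icc]; norm_num
  rw [hball] at hY hL
  refine ⟨Y, fun c hc => ⟨(hY c hc).1, fun x hx => ?_⟩, fun x hx => ?_⟩
  · refine ((hY c hc).2 x ⟨by linarith [hx.1], by linarith [hx.2]⟩).hasDerivAt ?_
    exact Icc_mem_nhds (by linarith [hx.1]) (by linarith [hx.2])
  · exact (hL x ⟨by linarith [hx.1], by linarith [hx.2]⟩).continuousOn

/-- A solution on `[-2, 2]` of a scalar `4`-periodic equation taking the same value at both ends
extends to a periodic solution. -/
theorem exists_periodic_extension {F : ℝ → ℝ → ℝ} (hF : ∀ x v, F (x + 4) v = F x v) {y : ℝ → ℝ}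
    (hy : ∀ x ∈ Icc (-2 : ℝ) 2, HasDerivAt y (F x (y x)) x) (h2 : y (-2) = y 2) :
    ∃ w : ℝ → ℝ, (∀ x, HasDerivAt w (F x (w x)) x) ∧ (∀ x, w (x + 4) = w x) ∧
      ∀ x ∈ Icc (-2 : ℝ) 2, w x = y x := by
  set w : ℝ → ℝ := fun x => y (toIcoMod (by norm_num : (0 : ℝ) < 4) (-2) x) with hw
  have wper : ∀ x, w (x + 4) = w x := fun x => by simp only [hw, toIcoMod_add_right]
  have weq' : ∀ x ∈ Ico (-2 : ℝ) 2, w x = y x := fun x hx => by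
    have : x ∈ Ico (-2 : ℝ) (-2 + 4) := by norm_num; exact hx
    simp only [hw, (toIcoMod_eq_self (by norm_num : (0 : ℝ) < 4)).2 this]
  have weq : ∀ x ∈ Icc (-2 : ℝ) 2, w x = y x := fun x hx => by
    rcases hx.2.eq_or_lt with h | h
    · rw [h, ← h2, ← weq' (-2) (by norm_num), ← wper (-2)]; norm_num
    · exact weq' x ⟨hx.1, h⟩
  have base : ∀ x ∈ Ico (-2 : ℝ) 2, HasDerivAt w (F x (w x)) x := by
    intro x hx
    rcases hx.1.eq_or_lt with h | h
    · subst h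
      rw [← hasDerivWithinAt_univ, ← Iic_union_Ici (a := (-2 : ℝ))]
      apply HasDerivWithinAt.union
      · have hd : HasDerivAt (fun x => y (x + 4)) (F 2 (y 2)) (-2) := by
          have := hy 2 (by norm_num)
          exact HasDerivAt.comp_add_const (-2) 4 (by norm_num; exact this)
        have e : F (-2) (w (-2)) = F 2 (y 2) := by
          rw [← hF, weq (-2) (by norm_num), h2]; norm_num
        rw [e]
        have ev : w =ᶠ[nhdsWithin (-2) (Iic (-2))] fun x => y (x + 4) := by
          have : Icc (-6 : ℝ) (-2) ∈ nhdsWithin (-2) (Iic (-2)) :=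
            Icc_mem_nhdsLE (by norm_num)
          filter_upwards [this] with z hz
          rw [← wper, weq _ ⟨by linarith [hz.1], by linarith [hz.2]⟩]
        exact hd.hasDerivWithinAt.congr_of_eventuallyEq ev (ev.self_of_nhdsWithin self_mem_Iic)
      · have ev : w =ᶠ[nhdsWithin (-2) (Ici (-2))] y := by
          have : Icc (-2 : ℝ) 2 ∈ nhdsWithin (-2) (Ici (-2)) :=
            Icc_mem_nhdsGE (by norm_num)
          filter_upwards [this] with z hz
          exact weq z hz
        rw [weq _ (by norm_num)]
        exact (hy (-2) (by norm_num)).hasDerivWithinAt.congr_of_eventuallyEq ev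
          (weq _ (by norm_num))
    · have ev : w =ᶠ[nhds x] y := by
        filter_upwards [Icc_mem_nhds h hx.2] with z hz using weq z hz
      rw [weq' x hx]
      exact (hy x (Ico_subset_Icc_self hx)).congr_of_eventuallyEq ev
  have wper' : Function.Periodic w 4 := wper
  have Fper' : ∀ v, Function.Periodic (fun x => F x v) 4 := fun v x => hF x v
  refine ⟨w, fun x => ?_, wper, weq⟩
  have hx := toIcoMod_mem_Ico (by norm_num : (0 : ℝ) < 4) (-2) x
  norm_num at hx
  set n := toIcoDiv (by norm_num : (0 : ℝ) < 4) (-2) x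
  have hxe : toIcoMod (by norm_num : (0 : ℝ) < 4) (-2) x = x - n * 4 := by
    rw [toIcoMod, zsmul_eq_mul]
  have hb := base _ hx
  rw [hxe] at hb
  rw [wper'.sub_int_mul_eq n] at hb
  have e2 := (Fper' (w x)).sub_int_mul_eq (x := x) n
  rw [e2] at hb
  have := HasDerivAt.comp_sub_const x (n * 4 : ℝ) hb
  simpa only [wper'.sub_int_mul_eq n] using this

theorem sin_le_sin_of_mem_Icc {α t : ℝ} (hα : 0 ≤ α) (h1 : α ≤ t) (h2 : t ≤ π - α) :
    sin α ≤ sin t := by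
  rcases le_total t (π / 2) with h | h
  · exact sin_le_sin_of_le_of_le_pi_div_two (by linarith [pi_pos]) h h1
  · rw [← sin_pi_sub t]
    exact sin_le_sin_of_le_of_le_pi_div_two (by linarith [pi_pos]) (by linarith) (by linarith)

theorem half_le_sin {x : ℝ} (h1 : 1 / 3 ≤ x) (h2 : x ≤ 5 / 3) : 1 / 2 ≤ sin (π * x / 2) := by
  rw [← sin_pi_div_six]
  apply sin_le_sin_of_mem_Icc <;> nlinarith [pi_pos]

theorem sin_half_nonneg {x : ℝ} (h1 : 0 ≤ x) (h2 : x ≤ 2) : 0 ≤ sin (π * x / 2) :=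
  sin_nonneg_of_nonneg_of_le_pi (by nlinarith [pi_pos]) (by nlinarith [pi_pos])

theorem sin_three_nonneg {x : ℝ} (h1 : 0 ≤ x) (h2 : x ≤ 2 / 3) : 0 ≤ sin (3 * π * x / 2) :=
  sin_nonneg_of_nonneg_of_le_pi (by nlinarith [pi_pos]) (by nlinarith [pi_pos])

theorem le_sin_three {x : ℝ} (h1 : 1 / 3 ≤ x) (h2 : x ≤ 2 / 3 - 1 / 10 ^ 5) :
    3 / 10 ^ 5 ≤ sin (3 * π * x / 2) := by
  have h := mul_le_sin (x := 3 / 2 * (1 / 10 ^ 5) * π) (by positivity) (by nlinarith [pi_pos])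
  have e : 2 / π * (3 / 2 * (1 / 10 ^ 5) * π) = 3 / 10 ^ 5 := by
    field_simp
  rw [e] at h
  refine h.trans (sin_le_sin_of_mem_Icc ?_ ?_ ?_) <;> nlinarith [pi_pos]

theorem sin_three_le {x : ℝ} (h1 : 2 / 3 - 3 / 10 ^ 5 ≤ x) (h2 : x ≤ 2 / 3) :
    sin (3 * π * x / 2) ≤ 15 / 10 ^ 5 := by
  rw [← sin_pi_sub]
  refine (sin_le ?_).trans ?_ <;> nlinarith [pi_pos, pi_lt_d2]

/-- The height of the undamped upper branch relative to its maximum. -/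
noncomputable def arch (x : ℝ) : ℝ := 2 / (3 * π) * (cos (3 * π * x / 2) - 1)

theorem hasDerivAt_arch (x : ℝ) : HasDerivAt arch (-sin (3 * π * x / 2)) x := by
  have h1 : HasDerivAt (fun x : ℝ => 3 * π * x / 2) (3 * π / 2) x := by
    simpa using ((hasDerivAt_id x).const_mul (3 * π)).div_const 2
  have h := (h1.cos.sub_const 1).const_mul (2 / (3 * π))
  refine h.congr_deriv ?_
  have := pi_ne_zero
  field_simp

theorem arch_zero : arch 0 = 0 := by simp [arch]

theorem arch_one_third : arch (1 / 3) = -(2 / (3 * π)) := by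
  rw [arch, show 3 * π * (1 / 3) / 2 = π / 2 by ring, cos_pi_div_two]; ring

theorem arch_four_ninths : arch (4 / 9) = -(1 / π) := by
  rw [arch, show 3 * π * (4 / 9) / 2 = π - π / 3 by ring, cos_pi_sub, cos_pi_div_three]
  field_simp
  norm_num

theorem arch_anti {x z : ℝ} (hx : 0 ≤ x) (hxz : x ≤ z) (hz : z ≤ 2 / 3) : arch z ≤ arch x := by
  have := sub_le_mul_of_deriv_le (C := 0) hxz (fun t _ => hasDerivAt_arch t) (fun t ht => by
    have := sin_three_nonneg (hx.trans ht.1) (ht.2.trans hz)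
    linarith)
  linarith

theorem arch_sub_ge {x z : ℝ} (hx : 1 / 3 ≤ x) (hxz : x ≤ z) (hz : z ≤ 2 / 3 - 1 / 10 ^ 5) :
    3 / 10 ^ 5 * (z - x) ≤ arch x - arch z := by
  have := sub_le_mul_of_deriv_le (C := -(3 / 10 ^ 5)) hxz (fun t _ => hasDerivAt_arch t)
    (fun t ht => by
      have := le_sin_three (hx.trans ht.1) (ht.2.trans hz)
      linarith)
  linarith

/-- `y` solves on `[0, 2]` the switching equation with damping coefficient `b`, in the unscaled
variable, and starts at `Y`. A negative `b` corresponds to reversing the sense of `x`. -/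
structure HalfSol (ψ : ℝ → ℝ) (b ε Y : ℝ) (y : ℝ → ℝ) : Prop where
  apply_zero : y 0 = Y
  hasDerivAt : ∀ x ∈ Icc (0 : ℝ) 2, HasDerivAt y (-(b * y x) - forcing x (ψ (y x / ε))) x

namespace HalfSol

variable {ψ : ℝ → ℝ} {M a b ε Y : ℝ} {y : ℝ → ℝ}

theorem abs_le_five (h : HalfSol ψ b ε Y y) (hψ : IsTransition ψ M) (hb : |b| ≤ 1 / 8)
    (hY : |Y| ≤ 1) : ∀ x ∈ Icc (0 : ℝ) 2, |y x| ≤ 5 := by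
  have key : ∀ x ∈ Icc (0 : ℝ) 2, |y x| ≤ 5 →
      |-(b * y x) - forcing x (ψ (y x / ε))| < 2 := by
    intro x _ hy
    calc _ ≤ |-(b * y x)| + |forcing x (ψ (y x / ε))| := abs_sub _ _
      _ ≤ 1 / 8 * 5 + 1 := by
        rw [abs_neg, abs_mul]
        gcongr
        exact abs_forcing_le x (hψ.abs_le_one _)
      _ < 2 := by norm_num
  have hd : ∀ x : ℝ, HasDerivAt (fun x : ℝ => 1 + 2 * x) 2 x := fun x => by
    simpa using ((hasDerivAt_id x).const_mul 2).const_add 1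
  have up := le_of_deriv_lt_of_eq h.hasDerivAt (fun x _ => hd x)
    (by have := (abs_le.1 hY).2; rw [h.apply_zero]; linarith) (fun x hx he => by
      have := key x hx (by rw [he, abs_of_nonneg] <;> linarith [hx.1, hx.2])
      exact (abs_lt.1 this).2)
  have lo := le_of_deriv_lt_of_eq (f := fun x => -y x) (fun x hx => (h.hasDerivAt x hx).neg)
    (fun x _ => hd x)
    (by have := (abs_le.1 hY).1; simp only [h.apply_zero]; linarith) (fun x hx he => by
      have := key x hx (by
        rw [← abs_neg, he, abs_of_nonneg] <;> linarith [hx.1, hx.2])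
      linarith [(abs_lt.1 this).1])
  intro x hx
  rw [abs_le]
  constructor <;> linarith [up x hx, lo x hx, hx.1, hx.2]

theorem abs_mul_le (h : HalfSol ψ b ε Y y) (hψ : IsTransition ψ M) (ha : a ≤ 1 / 10 ^ 11)
    (hb : |b| ≤ a) (hY : |Y| ≤ 1) : ∀ x ∈ Icc (0 : ℝ) 2, |b * y x| ≤ 5 * a := by
  intro x hx
  have := h.abs_le_five hψ (hb.trans (by linarith)) hY x hx
  rw [abs_mul]
  nlinarith [abs_nonneg b, abs_nonneg (y x)]

theorem arch_le (h : HalfSol ψ b ε Y y) (hψ : IsTransition ψ M) (ha0 : 0 < a)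
    (ha : a ≤ 1 / 10 ^ 11) (hb : |b| ≤ a) (hε : 0 < ε) (hY : |Y| ≤ 1) {Y' x₁ : ℝ} (hY' : Y' ≤ Y)
    (hx₁ : x₁ ≤ 2 / 3) (hpos : ε < Y' + arch x₁ - 6 * a) :
    ∀ x ∈ Icc 0 x₁, Y' + arch x - 6 * a ≤ y x := by
  have hsub : ∀ x ∈ Icc 0 x₁, x ∈ Icc (0 : ℝ) 2 := fun x hx => ⟨hx.1, by linarith [hx.2]⟩
  have := le_of_deriv_lt_of_eq (f := fun x => Y' + arch x - 6 * a * x)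
    (f' := fun x => -sin (3 * π * x / 2) - 6 * a)
    (fun x _ => by
      simpa using ((hasDerivAt_arch x).const_add Y').fun_sub ((hasDerivAt_id x).const_mul (6 * a)))
    (fun x hx => h.hasDerivAt x (hsub x hx)) (by simpa [arch_zero, h.apply_zero] using hY')
    (fun x hx he => by
      have h1 := arch_anti hx.1 hx.2 hx₁
      have h2 : ε ≤ y x := by rw [← he]; nlinarith [hx.1, hx.2]
      have h3 := h.abs_mul_le hψ ha hb hY x (hsub x hx)
      rw [hψ.eq_one _ ((one_le_div hε).2 h2), forcing_one]
      linarith [(abs_le.1 h3).2])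
  intro x hx
  nlinarith [this x hx, hx.1, hx.2]

theorem exists_hit (h : HalfSol ψ b ε Y y) (hψ : IsTransition ψ M)
    (ha : a ≤ 1 / 10 ^ 11) (ha0 : 0 < a) (hb : |b| ≤ a) (hε : 0 < ε) (hY : |Y| ≤ 1)
    (hεY : ε < Y) {x₁ : ℝ} (hx₀ : 0 ≤ x₁) (hx₁ : x₁ ≤ 2 / 3) (hneg : Y + arch x₁ + 6 * a < ε) :
    ∃ p ∈ Icc 0 x₁, y p = ε ∧ ∀ x ∈ Icc 0 p, ε ≤ y x := by
  have hsub : ∀ x ∈ Icc 0 x₁, x ∈ Icc (0 : ℝ) 2 := fun x hx => ⟨hx.1, by linarith [hx.2]⟩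
  have hz : ∃ z ∈ Icc 0 x₁, y z ≤ ε := by
    by_contra! hall
    have := le_of_deriv_le (fun x hx => h.hasDerivAt x (hsub x hx))
      (B := fun x => Y + arch x + 6 * a * x)
      (B' := fun x => -sin (3 * π * x / 2) + 6 * a)
      (fun x _ => by
        simpa using ((hasDerivAt_arch x).const_add Y).fun_add ((hasDerivAt_id x).const_mul (6 * a)))
      (by simp [arch_zero, h.apply_zero]) (fun x hx => by
        have h3 := h.abs_mul_le hψ ha hb hY x (hsub x hx)
        rw [hψ.eq_one _ ((one_le_div hε).2 (hall x hx).le), forcing_one]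
        linarith [(abs_le.1 h3).1]) x₁ ⟨hx₀, le_rfl⟩
    nlinarith [hall x₁ ⟨hx₀, le_rfl⟩]
  obtain ⟨z, hz, hyz⟩ := hz
  obtain ⟨p, hp, h1, h2⟩ := exists_first_hit hz.1 (fun x hx =>
    (h.hasDerivAt x (hsub x ⟨hx.1, hx.2.trans hz.2⟩)).continuousAt.continuousWithinAt)
    (by rw [h.apply_zero]; exact hεY) hyz
  exact ⟨p, ⟨hp.1, hp.2.trans hz.2⟩, h1, h2⟩

end HalfSol

/-- `y` stays above the layer `|y| ≤ ε` up to `p` and below it from `p + 2 * 10 ^ 5 * ε` on. -/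
structure CrossesAt (ε p : ℝ) (y : ℝ → ℝ) : Prop where
  eq : y p = ε
  above : ∀ x ∈ Icc 0 p, ε ≤ y x
  below : ∀ x ∈ Icc (p + 2 * 10 ^ 5 * ε) 2, y x ≤ -ε
  below' : ∀ x ∈ Icc (p + 2 * 10 ^ 5 * ε) (5 / 3), y x ≤ -(49 / 100 * (x - (p + 2 * 10 ^ 5 * ε)))

namespace HalfSol

variable {ψ : ℝ → ℝ} {M a b ε Y : ℝ} {y : ℝ → ℝ}

theorem exists_crossesAt (h : HalfSol ψ b ε Y y) (hψ : IsTransition ψ M)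
    (ha0 : 0 < a) (ha : a ≤ 1 / 10 ^ 11) (hb : |b| ≤ a) (hε : 0 < ε) (hεa : ε ≤ a) (hY : |Y| ≤ 1)
    (hY₁ : 1 / π ≤ Y) {x₁ : ℝ} (hx₀ : 0 ≤ x₁) (hx₁ : x₁ ≤ 2 / 3 - 1 / 10 ^ 5 - 2 * 10 ^ 5 * ε)
    (hneg : Y + arch x₁ + 6 * a < ε) :
    ∃ p ∈ Icc (1 / 3) x₁, CrossesAt ε p y := by
  have hx₁' : x₁ ≤ 2 / 3 := by linarith
  have hpi : 1 / 10 ≤ 1 / π + arch (1 / 3) := by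
    rw [arch_one_third]
    have : 1 / π + -(2 / (3 * π)) = 1 / (3 * π) := by field_simp; norm_num
    rw [this, div_le_div_iff₀ (by norm_num) (by positivity)]
    linarith [pi_lt_d2]
  have hlow := h.arch_le hψ ha0 ha hb hε hY hY₁ (x₁ := 1 / 3) (by norm_num) (by linarith)
  have hpi' : arch (1 / 3) ≤ 0 := by rw [arch_one_third]; simp; positivity
  obtain ⟨p, hp, hyp, habove⟩ := h.exists_hit hψ ha ha0 hb hε hY (by linarith) hx₀ hx₁' hneg
  have hp3 : 1 / 3 ≤ p := by
    by_contra! hlt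
    have h1 := hlow p ⟨hp.1, hlt.le⟩
    have h2 := arch_anti hp.1 hlt.le (by norm_num)
    linarith
  set q := p + 2 * 10 ^ 5 * ε with hq
  have hpq : p ≤ q := by rw [hq]; linarith
  have hq2 : q ≤ 2 / 3 - 1 / 10 ^ 5 := by linarith [hp.2]
  have hyq : y q ≤ -ε := by
    have := sub_le_mul_of_deriv_le (C := -(1 / 10 ^ 5)) hpq
      (fun x hx => h.hasDerivAt x ⟨by linarith [hx.1], by linarith [hx.2]⟩) (fun x hx => by
        have h3 := h.abs_mul_le hψ ha hb hY x ⟨by linarith [hx.1], by linarith [hx.2]⟩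
        have hs := half_le_sin (hp3.trans hx.1) (by linarith [hx.2])
        have h4 := le_forcing (hψ.abs_le_one (y x / ε)) (k := 3 / 10 ^ 5)
          (by linarith) (le_sin_three (hp3.trans hx.1) (hx.2.trans hq2))
        linarith [(abs_le.1 h3).1])
    rw [hyp] at this
    linarith
  have hneg1 : ∀ x, y x ≤ -ε → ψ (y x / ε) = -1 := fun x hx =>
    hψ.eq_neg_one _ ((div_le_iff₀ hε).2 (by linarith))
  have hb1 := le_of_deriv_lt_of_eq (p := q) (q := 5 / 3)
    (fun x hx => h.hasDerivAt x ⟨by linarith [hx.1], by linarith [hx.2]⟩)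
    (B := fun x => -ε - 49 / 100 * (x - q)) (B' := fun x => -(49 / 100))
    (fun x _ => by
      simpa using (((hasDerivAt_id x).sub_const q).const_mul (49 / 100)).const_sub (-ε))
    (by simpa using hyq) (fun x hx he => by
      have h3 := h.abs_mul_le hψ ha hb hY x ⟨by linarith [hx.1], by linarith [hx.2]⟩
      have hs := half_le_sin (by linarith [hx.1] : 1 / 3 ≤ x) (by linarith [hx.2])
      rw [hneg1 x (by linarith [hx.1]), forcing_neg_one]
      linarith [(abs_le.1 h3).1])
  have h53 := hb1 (5 / 3) ⟨by linarith, le_rfl⟩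
  have hb2 := le_of_deriv_lt_of_eq (p := 5 / 3) (q := 2)
    (fun x hx => h.hasDerivAt x ⟨by linarith [hx.1], by linarith [hx.2]⟩)
    (B := fun x => -ε - 2 / 5 + 6 * a * (x - 5 / 3)) (B' := fun x => 6 * a)
    (fun x _ => by
      simpa using (((hasDerivAt_id x).sub_const (5 / 3)).const_mul (6 * a)).const_add (-ε - 2 / 5))
    (by simp only [sub_self, mul_zero, add_zero]; linarith) (fun x hx he => by
      have h3 := h.abs_mul_le hψ ha hb hY x ⟨by linarith [hx.1], by linarith [hx.2]⟩
      have hs := sin_half_nonneg (by linarith [hx.1] : 0 ≤ x) hx.2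
      rw [hneg1 x (by rw [he]; nlinarith [hx.1, hx.2]), forcing_neg_one]
      linarith [(abs_le.1 h3).1])
  refine ⟨p, ⟨hp3, hp.2⟩, hyp, habove, fun x hx => ?_, fun x hx => ?_⟩
  · rcases le_total x (5 / 3) with h5 | h5
    · have := hb1 x ⟨hx.1, h5⟩
      have := hx.1
      linarith
    · have := hb2 x ⟨h5, hx.2⟩
      nlinarith [hx.2]
  · linarith [hb1 x hx]

end HalfSol

section Shooting

variable {ψ : ℝ → ℝ} {M a ε Y : ℝ} {y w : ℝ → ℝ}

theorem HalfSol.hasDerivAt_sub (hy : HalfSol ψ a ε Y y) (hw : HalfSol ψ (-a) ε Y w) :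
    ∀ x ∈ Icc (0 : ℝ) 2, HasDerivAt (fun x => w x - y x)
      (a * (y x + w x) - (forcing x (ψ (w x / ε)) - forcing x (ψ (y x / ε)))) x := by
  intro x hx
  refine ((hw.hasDerivAt x hx).sub (hy.hasDerivAt x hx)).congr_deriv ?_
  ring

theorem IsTransition.apply_div_of_le (hψ : IsTransition ψ M) (hε : 0 < ε) {u : ℝ} (hu : ε ≤ u) :
    ψ (u / ε) = 1 :=
  hψ.eq_one _ ((one_le_div hε).2 hu)

theorem IsTransition.apply_div_of_le_neg (hψ : IsTransition ψ M) (hε : 0 < ε) {u : ℝ}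
    (hu : u ≤ -ε) : ψ (u / ε) = -1 :=
  hψ.eq_neg_one _ ((div_le_iff₀ hε).2 (by linarith))

theorem abs_one_div_pi_le : |1 / π| ≤ 1 := by
  rw [abs_of_pos (by positivity), div_le_one pi_pos]
  linarith [pi_gt_three]

theorem cos_nonneg_of_le_half {x : ℝ} (h0 : 0 ≤ x) (h1 : x ≤ 1 / 2) : 0 ≤ cos (π * x) :=
  cos_nonneg_of_neg_pi_div_two_le_of_le (by nlinarith [pi_pos]) (by nlinarith [pi_pos])

theorem cos_nonpos_of_half_le {x : ℝ} (h0 : 1 / 2 ≤ x) (h1 : x ≤ 3 / 2) : cos (π * x) ≤ 0 :=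
  cos_nonpos_of_pi_div_two_le_of_le (by nlinarith [pi_pos]) (by nlinarith [pi_pos])

/-- From a low initial height the solution gains height over a period. -/
theorem shooting_low (hψ : IsTransition ψ M) (ha0 : 0 < a) (ha : a ≤ 1 / 10 ^ 11) (hε : 0 < ε)
    (hεa : 4000 * ε ≤ a) (hy : HalfSol ψ a ε (1 / π) y) (hw : HalfSol ψ (-a) ε (1 / π) w) :
    w 2 ≤ y 2 := by
  have hb1 : |a| ≤ a := (abs_of_pos ha0).le
  have hb2 : |-a| ≤ a := by rw [abs_neg]; exact hb1
  have hπ := abs_one_div_pi_le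
  have hπ' : 1 / π ≤ 0.3184 := by
    rw [div_le_iff₀ pi_pos]; linarith [pi_gt_d4]
  have hneg : 1 / π + arch (17 / 36) + 6 * a < ε := by
    have := arch_sub_ge (x := 4 / 9) (z := 17 / 36) (by norm_num) (by norm_num) (by norm_num)
    rw [arch_four_ninths] at this
    linarith
  obtain ⟨p, hp, cy⟩ := hy.exists_crossesAt hψ ha0 ha hb1 hε (by linarith) hπ le_rfl
    (x₁ := 17 / 36) (by norm_num) (by linarith) hneg
  obtain ⟨p', hp', cw⟩ := hw.exists_crossesAt hψ ha0 ha hb2 hε (by linarith) hπ le_rfl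
    (x₁ := 17 / 36) (by norm_num) (by linarith) hneg
  have hq : p + 2 * 10 ^ 5 * ε ≤ 1 / 2 := by linarith [hp.2]
  have hq' : p' + 2 * 10 ^ 5 * ε ≤ 1 / 2 := by linarith [hp'.2]
  have upper : ∀ {b : ℝ} {z : ℝ → ℝ}, |b| ≤ a → HalfSol ψ b ε (1 / π) z →
      ∀ x ∈ Icc (0 : ℝ) (1 / 2), z x ≤ 0.32 := by
    intro b z hb hz x hx
    have := sub_le_mul_of_deriv_le (C := 5 * a) hx.1
      (fun t ht => hz.hasDerivAt t ⟨ht.1, by linarith [ht.2, hx.2]⟩) (fun t ht => by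
        have h3 := hz.abs_mul_le hψ ha hb hπ t ⟨ht.1, by linarith [ht.2, hx.2]⟩
        have h4 := le_forcing (hψ.abs_le_one (z t / ε)) (k := 0)
          (sin_half_nonneg ht.1 (by linarith [ht.2, hx.2]))
          (sin_three_nonneg ht.1 (by linarith [ht.2, hx.2]))
        linarith [(abs_le.1 h3).1])
    rw [hz.apply_zero] at this
    nlinarith [hx.1, hx.2]
  have hd := hy.hasDerivAt_sub hw
  have s1 := le_of_deriv_lt_of_eq (p := 0) (q := 1 / 2)
    (fun x hx => hd x ⟨hx.1, by linarith [hx.2]⟩)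
    (B := fun x => 0.66 * a * x) (B' := fun _ => 0.66 * a)
    (fun x _ => by simpa using (hasDerivAt_id x).const_mul (0.66 * a))
    (by simp [hy.apply_zero, hw.apply_zero]) (fun x hx he => by
      have hyw : y x ≤ w x := by
        have : 0 ≤ 0.66 * a * x := mul_nonneg (by linarith) hx.1
        linarith
      have hm := hψ.monotone (div_le_div_of_nonneg_right hyw hε.le)
      rw [forcing_sub]
      have h1 := upper hb1 hy x hx
      have h2 := upper hb2 hw x hx
      have h3 := mul_nonneg (mul_nonneg (cos_nonneg_of_le_half hx.1 hx.2)
        (sin_half_nonneg hx.1 (by linarith [hx.2]))) (sub_nonneg.2 hm)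
      nlinarith) (1 / 2) (by norm_num)
  have low : ∀ x ∈ Icc (1 / 2 : ℝ) 2,
      forcing x (ψ (w x / ε)) - forcing x (ψ (y x / ε)) = 0 := fun x hx => by
    rw [hψ.apply_div_of_le_neg hε (cw.below x ⟨by linarith [hx.1], hx.2⟩),
      hψ.apply_div_of_le_neg hε (cy.below x ⟨by linarith [hx.1], hx.2⟩), sub_self]
  have s2 := le_of_deriv_le (p := 1 / 2) (q := 5 / 3)
    (fun x hx => hd x ⟨by linarith [hx.1], by linarith [hx.2]⟩)
    (B := fun x => 0.33 * a - 0.49 * a * (x - 1 / 2) ^ 2)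
    (B' := fun x => -(0.98 * a * (x - 1 / 2)))
    (fun x _ => by
      have := ((((hasDerivAt_id x).sub_const (1 / 2)).pow 2).const_mul (0.49 * a)).const_sub
        (0.33 * a)
      refine this.congr_deriv ?_
      simp only [id]
      norm_num
      ring)
    (by simp only [sub_self]; linarith) (fun x hx => by
      rw [low x ⟨hx.1, by linarith [hx.2]⟩]
      have h1 := cy.below' x ⟨by linarith [hx.1], hx.2⟩
      have h2 := cw.below' x ⟨by linarith [hx.1], hx.2⟩
      nlinarith) (5 / 3) (by norm_num)
  have s3 := sub_le_mul_of_deriv_le (p := 5 / 3) (q := 2) (C := 0) (by norm_num)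
    (fun x hx => hd x ⟨by linarith [hx.1], by linarith [hx.2]⟩) (fun x hx => by
      rw [low x ⟨by linarith [hx.1], hx.2⟩]
      have h1 := cy.below x ⟨by linarith [hx.1], hx.2⟩
      have h2 := cw.below x ⟨by linarith [hx.1], hx.2⟩
      nlinarith)
  norm_num at s2
  nlinarith

theorem one_div_pi_le_neg_arch : 1 / π ≤ -arch (2 / 3 - 2 / 10 ^ 5) := by
  have := arch_anti (x := 4 / 9) (z := 2 / 3 - 2 / 10 ^ 5) (by norm_num) (by norm_num)
    (by norm_num)
  rw [arch_four_ninths] at this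
  linarith

theorem neg_arch_le_one (x : ℝ) : -arch x ≤ 1 := by
  have h1 := neg_one_le_cos (3 * π * x / 2)
  have h2 : 2 / (3 * π) ≤ 1 / 2 := by
    rw [div_le_div_iff₀ (by positivity) (by norm_num)]; linarith [pi_gt_three]
  have h3 : 0 < 2 / (3 * π) := by positivity
  rw [arch]
  nlinarith

/-- From a high initial height the solution loses height over a period. -/
theorem shooting_high (hψ : IsTransition ψ M) (ha0 : 0 < a) (ha : a ≤ 1 / 10 ^ 11) (hε : 0 < ε)
    (hεa : 4000 * ε ≤ a) (hYe : Y = -arch (2 / 3 - 2 / 10 ^ 5)) (hy : HalfSol ψ a ε Y y)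
    (hw : HalfSol ψ (-a) ε Y w) : y 2 ≤ w 2 := by
  have hb1 : |a| ≤ a := (abs_of_pos ha0).le
  have hb2 : |-a| ≤ a := by rw [abs_neg]; exact hb1
  have hY1 : 1 / π ≤ Y := hYe ▸ one_div_pi_le_neg_arch
  have hY : |Y| ≤ 1 := by
    rw [abs_of_nonneg (le_trans (by positivity) hY1), hYe]; exact neg_arch_le_one _
  have hneg : Y + arch (2 / 3 - 3 / 2 / 10 ^ 5) + 6 * a < ε := by
    have := arch_sub_ge (x := 2 / 3 - 2 / 10 ^ 5) (z := 2 / 3 - 3 / 2 / 10 ^ 5) (by norm_num)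
      (by norm_num) (by norm_num)
    norm_num at this ha hYe ⊢
    linarith
  have hpos : ε < Y + arch (2 / 3 - 3 / 10 ^ 5) - 6 * a := by
    have := arch_sub_ge (x := 2 / 3 - 3 / 10 ^ 5) (z := 2 / 3 - 2 / 10 ^ 5) (by norm_num)
      (by norm_num) (by norm_num)
    norm_num at this ha hYe ⊢
    linarith
  obtain ⟨p, hp, cy⟩ := hy.exists_crossesAt hψ ha0 ha hb1 hε (by linarith) hY hY1
    (x₁ := 2 / 3 - 3 / 2 / 10 ^ 5) (by norm_num) (by norm_num; linarith) hneg
  obtain ⟨p', hp', cw⟩ := hw.exists_crossesAt hψ ha0 ha hb2 hε (by linarith) hY hY1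
    (x₁ := 2 / 3 - 3 / 2 / 10 ^ 5) (by norm_num) (by norm_num; linarith) hneg
  have hp2 : p ≤ 2 / 3 - 3 / 2 / 10 ^ 5 := hp.2
  have hp2' : p' ≤ 2 / 3 - 3 / 2 / 10 ^ 5 := hp'.2
  have hp1 : 2 / 3 - 3 / 10 ^ 5 ≤ p := by
    by_contra! hlt
    have h1 := hy.arch_le hψ ha0 ha hb1 hε hY le_rfl (by norm_num) hpos p
      ⟨by linarith [hp.1], hlt.le⟩
    have h2 := arch_anti (by linarith [hp.1]) hlt.le (by norm_num)
    linarith [cy.eq]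
  have hylow : ∀ x ∈ Icc (0 : ℝ) (1 / 3), 0.099 ≤ y x := by
    intro x hx
    have hpi : 1 / 10 ≤ 1 / π + arch (1 / 3) := by
      rw [arch_one_third]
      have : 1 / π + -(2 / (3 * π)) = 1 / (3 * π) := by field_simp; norm_num
      rw [this, div_le_div_iff₀ (by norm_num) (by positivity)]
      linarith [pi_lt_d2]
    have h1 := hy.arch_le hψ ha0 ha hb1 hε hY hY1 (x₁ := 1 / 3) (by norm_num) (by linarith) x hx
    have h2 := arch_anti hx.1 hx.2 (by norm_num)
    linarith
  have hd := hy.hasDerivAt_sub hw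
  have bnd : ∀ x ∈ Icc (0 : ℝ) 2, -(10 * a) ≤ a * (y x + w x) := fun x hx => by
    have h1 := (abs_le.1 (hy.abs_mul_le hψ ha hb1 hY x hx)).1
    have h2 := (abs_le.1 (hw.abs_mul_le hψ ha hb2 hY x hx)).2
    linarith
  have hyw : ∀ x ∈ Icc 0 p, y x ≤ w x := le_of_deriv_lt_of_eq
    (fun x hx => hy.hasDerivAt x ⟨hx.1, by linarith [hx.2]⟩)
    (fun x hx => hw.hasDerivAt x ⟨hx.1, by linarith [hx.2]⟩) (by rw [hy.apply_zero, hw.apply_zero])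
    (fun x hx he => by
      have h1 := cy.above x hx
      rw [← he]
      nlinarith)
  have up : ∀ x ∈ Icc 0 p, forcing x (ψ (w x / ε)) - forcing x (ψ (y x / ε)) = 0 :=
    fun x hx => by
      rw [hψ.apply_div_of_le hε (cy.above x hx),
        hψ.apply_div_of_le hε ((cy.above x hx).trans (hyw x hx)), sub_self]
  have s1 := mul_le_sub_of_le_deriv (p := 0) (q := 1 / 3) (C := 0.198 * a) (by norm_num)
    (fun x hx => hd x ⟨hx.1, by linarith [hx.2]⟩) (fun x hx => by
      have hx' : x ∈ Icc 0 p := ⟨hx.1, by linarith [hx.2]⟩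
      rw [up x hx']
      nlinarith [hylow x hx, hyw x hx'])
  rw [hy.apply_zero, hw.apply_zero] at s1
  have s2 := mul_le_sub_of_le_deriv (p := 1 / 3) (q := p) (C := 0) hp.1
    (fun x hx => hd x ⟨by linarith [hx.1], by linarith [hx.2]⟩) (fun x hx => by
      have hx' : x ∈ Icc 0 p := ⟨by linarith [hx.1], hx.2⟩
      rw [up x hx']
      nlinarith [cy.above x hx', hyw x hx'])
  have hwp : ε + 0.06 * a ≤ w p := by linarith [cy.eq]
  have h200 : p + 200 * a ≤ 2 / 3 := by linarith
  have hwup : ∀ x ∈ Icc p (p + 200 * a), ε ≤ w x := by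
    have := le_of_deriv_lt_of_eq (p := p) (q := p + 200 * a)
      (f := fun x => ε + 0.06 * a - 2 / 10 ^ 4 * (x - p)) (f' := fun _ => -(2 / 10 ^ 4))
      (fun x _ => by
        simpa using (((hasDerivAt_id x).sub_const p).const_mul (2 / 10 ^ 4)).const_sub
          (ε + 0.06 * a))
      (fun x hx => hw.hasDerivAt x ⟨by linarith [hx.1], by linarith [hx.2]⟩)
      (by simpa using hwp) (fun x hx he => by
        have h1 : ε ≤ w x := by rw [← he]; linarith [hx.2]
        rw [hψ.apply_div_of_le hε h1, forcing_one]
        have := sin_three_le (hp1.trans hx.1) (hx.2.trans h200)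
        nlinarith)
    intro x hx
    refine le_trans ?_ (this x hx)
    linarith [hx.2]
  have cs : ∀ x ∈ Icc p (2 / 3), cos (π * x) * sin (π * x / 2) ≤ 0 := fun x hx =>
    mul_nonpos_of_nonpos_of_nonneg
      (cos_nonpos_of_half_le (by linarith [hx.1]) (by linarith [hx.2]))
      (sin_half_nonneg (by linarith [hx.1]) (by linarith [hx.2]))
  have s3 := mul_le_sub_of_le_deriv (p := p) (q := p + 50 * a) (C := -(10 * a)) (by linarith)
    (fun x hx => hd x ⟨by linarith [hx.1], by linarith [hx.2]⟩) (fun x hx => by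
      have h1 := bnd x ⟨by linarith [hx.1], by linarith [hx.2]⟩
      rw [forcing_sub, hψ.apply_div_of_le hε (hwup x ⟨hx.1, by linarith [hx.2]⟩)]
      have h2 := cs x ⟨hx.1, by linarith [hx.2]⟩
      have h3 := (abs_le.1 (hψ.abs_le_one (y x / ε))).2
      nlinarith)
  have s4 := mul_le_sub_of_le_deriv (p := p + 50 * a) (q := p + 200 * a) (C := 0.49)
    (by linarith)
    (fun x hx => hd x ⟨by linarith [hx.1], by linarith [hx.2]⟩) (fun x hx => by
      have h1 := bnd x ⟨by linarith [hx.1], by linarith [hx.2]⟩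
      rw [hψ.apply_div_of_le hε (hwup x ⟨by linarith [hx.1], hx.2⟩),
        hψ.apply_div_of_le_neg hε (cy.below x ⟨by linarith [hx.1], by linarith [hx.2]⟩),
        forcing_one, forcing_neg_one]
      have h2 := sin_three_le (x := x) (by linarith [hx.1]) (by linarith [hx.2])
      have h3 := half_le_sin (x := x) (by linarith [hx.1]) (by linarith [hx.2])
      linarith)
  have s5 := mul_le_sub_of_le_deriv (p := p + 200 * a) (q := 2) (C := -(10 * a)) (by linarith)
    (fun x hx => hd x ⟨by linarith [hx.1], hx.2⟩) (fun x hx => by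
      have h1 := bnd x ⟨by linarith [hx.1], hx.2⟩
      rw [forcing_sub,
        hψ.apply_div_of_le_neg hε (cy.below x ⟨by linarith [hx.1], hx.2⟩)]
      rcases le_total x (2 / 3) with h | h
      · have h2 := cs x ⟨by linarith [hx.1], h⟩
        have h3 := (abs_le.1 (hψ.abs_le_one (w x / ε))).1
        nlinarith
      · rw [hψ.apply_div_of_le_neg hε (cw.below x ⟨by linarith [hx.1], hx.2⟩)]
        linarith)
  nlinarith

end Shooting

theorem eq_of_deriv_eq_zero {f f' : ℝ → ℝ} {p q : ℝ} (hpq : p ≤ q)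
    (hf : ∀ x ∈ Icc p q, HasDerivAt f (f' x) x) (h0 : ∀ x ∈ Icc p q, f' x = 0) : f q = f p := by
  have h1 := sub_le_mul_of_deriv_le hpq hf fun x hx => (h0 x hx).le
  have h2 := mul_le_sub_of_le_deriv hpq hf fun x hx => (h0 x hx).ge
  linarith

theorem hasDerivAt_cos_pi (x : ℝ) : HasDerivAt (fun x => cos (π * x)) (-(π * sin (π * x))) x := by
  have h1 : HasDerivAt (fun x : ℝ => π * x) π x := by
    simpa using (hasDerivAt_id x).const_mul π
  exact h1.cos.congr_deriv (by ring)

theorem abs_pi_mul_sin_le (x : ℝ) : |π * sin x| ≤ 7 / 2 := by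
  rw [abs_mul, abs_of_pos pi_pos]
  nlinarith [pi_pos, pi_lt_d2, abs_sin_le_one x, abs_nonneg (sin x)]

theorem le_one_add_mul_cos {x u : ℝ} (hu : |u| ≤ 1) (h1 : 1 / 3 ≤ x)
    (h2 : x ≤ 2 / 3 - 1 / 10 ^ 5) : 3 / 10 ^ 5 ≤ 1 + (1 + u) * cos (π * x) := by
  have hs := half_le_sin h1 (by linarith)
  have hf := le_forcing hu (k := 3 / 10 ^ 5) (by linarith) (le_sin_three h1 h2)
  rw [forcing] at hf
  have := sin_le_one (π * x / 2)
  have hpos : 0 < 1 + (1 + u) * cos (π * x) := by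
    by_contra! h
    nlinarith
  nlinarith

/-- Crossing the layer at `p` changes the logarithm of the transversal derivative by
`log (1 + 2 * cos (π * p))`, up to `O(ε)`. -/
theorem HalfSol.abs_gain_sub_log_le {ψ : ℝ → ℝ} {M b ε Y p : ℝ} {y G : ℝ → ℝ}
    (h : HalfSol ψ b ε Y y) (hψ : IsTransition ψ M) (hb : |b| ≤ 1) (hε : 0 < ε)
    (c : CrossesAt ε p y) (hp : 1 / 3 ≤ p) (hq : p + 2 * 10 ^ 5 * ε ≤ 2 / 3 - 1 / 10 ^ 5)
    (hG : ∀ x ∈ Icc (0 : ℝ) 2,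
      HasDerivAt G (cos (π * x) * sin (π * x / 2) * deriv ψ (y x / ε) / ε) x) :
    |G 2 - G 0 - log (1 + 2 * cos (π * p))| ≤
      (M + 7) / (3 / 10 ^ 5) * (2 * 10 ^ 5 * ε) := by
  set q := p + 2 * 10 ^ 5 * ε with hqd
  have hpq : p ≤ q := by rw [hqd]; linarith
  have hsub : ∀ x ∈ Icc p q, x ∈ Icc (0 : ℝ) 2 := fun x hx =>
    ⟨by linarith [hx.1], by linarith [hx.2]⟩
  have e1 : G p = G 0 := by
    refine eq_of_deriv_eq_zero (by linarith) (fun x hx => hG x ⟨hx.1, by linarith [hx.2]⟩) ?_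
    intro x hx
    rw [hψ.deriv_eq_zero _ (((one_le_div hε).2 (c.above x hx)).trans (le_abs_self _))]
    simp
  have e2 : G 2 = G q := by
    refine eq_of_deriv_eq_zero (by linarith) (fun x hx => hG x ⟨by linarith [hx.1], hx.2⟩) ?_
    intro x hx
    have h1 : y x / ε ≤ -1 := (div_le_iff₀ hε).2 (by linarith [c.below x hx])
    rw [hψ.deriv_eq_zero _ (by rw [abs_of_neg (by linarith)]; linarith)]
    simp
  set H : ℝ → ℝ := fun x => 1 + (1 + ψ (y x / ε)) * cos (π * x) with hH
  have hHlow : ∀ x ∈ Icc p q, 3 / 10 ^ 5 ≤ H x := fun x hx =>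
    le_one_add_mul_cos (hψ.abs_le_one _) (hp.trans hx.1) (hx.2.trans hq)
  set S' : ℝ → ℝ := fun x =>
    -(b * (y x / ε * deriv ψ (y x / ε)) * cos (π * x) +
      (1 + ψ (y x / ε)) * (π * sin (π * x))) / H x with hS'
  have hS : ∀ x ∈ Icc p q, HasDerivAt (fun x => G x + log (H x)) (S' x) x := by
    intro x hx
    have hpos : 0 < H x := lt_of_lt_of_le (by norm_num) (hHlow x hx)
    have hy := (h.hasDerivAt x (hsub x hx)).div_const ε
    have h1 : HasDerivAt (fun x => ψ (y x / ε)) _ x := (hψ.hasDerivAt (y x / ε)).comp x hy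
    have hH' := ((h1.const_add 1).mul (hasDerivAt_cos_pi x)).const_add 1
    refine ((hG x (hsub x hx)).add (hH'.log hpos.ne')).congr_deriv ?_
    have hne : 1 + (1 + ψ (y x / ε)) * cos (π * x) ≠ 0 := hpos.ne'
    simp only [hS', hH, forcing, Pi.mul_apply]
    generalize deriv ψ (y x / ε) = D at *
    generalize ψ (y x / ε) = P at *
    generalize cos (π * x) = C at *
    generalize sin (π * x / 2) = S at *
    obtain ⟨N, hN⟩ : ∃ N, N = 1 + (1 + P) * C := ⟨_, rfl⟩
    rw [← hN] at hne ⊢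
    field_simp
    ring
  have hbound : ∀ x ∈ Icc p q, |S' x| ≤ (M + 7) / (3 / 10 ^ 5) := by
    intro x hx
    have hl := hHlow x hx
    have hpos : 0 < H x := lt_of_lt_of_le (by norm_num) hl
    rw [hS', abs_div, abs_neg, abs_of_pos hpos]
    have hM := hψ.bound_nonneg
    have h1 : |b * (y x / ε * deriv ψ (y x / ε)) * cos (π * x)| ≤ M := by
      rw [abs_mul, abs_mul]
      calc _ ≤ 1 * M * 1 := by
            gcongr
            · exact hψ.abs_mul_deriv_le _
            · exact abs_cos_le_one _
        _ = M := by ring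
    have h2 : |(1 + ψ (y x / ε)) * (π * sin (π * x))| ≤ 7 := by
      rw [abs_mul]
      have := hψ.abs_le_one (y x / ε)
      have h3 : |1 + ψ (y x / ε)| ≤ 2 := by
        rw [abs_le] at this ⊢
        constructor <;> linarith
      have := mul_le_mul h3 (abs_pi_mul_sin_le (π * x)) (abs_nonneg _) zero_le_two
      linarith
    exact div_le_div₀ (by linarith) ((abs_add_le _ _).trans (add_le_add h1 h2)) (by norm_num) hl
  have u1 := sub_le_mul_of_deriv_le hpq hS fun x hx => (abs_le.1 (hbound x hx)).2
  have u2 := mul_le_sub_of_le_deriv hpq hS fun x hx => (abs_le.1 (hbound x hx)).1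
  have hq1 : H q = 1 := by
    simp [hH, hψ.apply_div_of_le_neg hε (c.below q ⟨le_rfl, by linarith⟩)]
  have hp1 : H p = 1 + 2 * cos (π * p) := by
    simp only [hH]
    rw [hψ.apply_div_of_le hε c.eq.ge]
    ring
  have e3 : q - p = 2 * 10 ^ 5 * ε := by rw [hqd]; ring
  simp only [hq1, hp1, log_one, e3] at u1 u2
  rw [abs_le, e2]
  constructor <;> linarith

/-- Two solutions with opposite damping that agree at `x = 2` cannot have the damped one
cross much later. -/
theorem CrossesAt.sub_le {ψ : ℝ → ℝ} {M a ε Y p p' : ℝ} {y w : ℝ → ℝ}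
    (cy : CrossesAt ε p y) (cw : CrossesAt ε p' w) (hψ : IsTransition ψ M) (ha0 : 0 < a)
    (ha : a ≤ 1 / 10 ^ 11) (hε : 0 < ε) (hY : |Y| ≤ 1)
    (hy : HalfSol ψ a ε Y y) (hw : HalfSol ψ (-a) ε Y w) (h2 : y 2 = w 2)
    (hq : p + 2 * 10 ^ 5 * ε ≤ 2 / 3) (hp' : 1 / 3 ≤ p') :
    p - p' ≤ 8 * 10 ^ 5 * ε := by
  by_contra! hlt
  set q := p + 2 * 10 ^ 5 * ε with hqd
  set q' := p' + 2 * 10 ^ 5 * ε with hqd'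
  have hq'q : q' ≤ q := by rw [hqd, hqd']; linarith
  have hb1 : |a| ≤ a := (abs_of_pos ha0).le
  have hyq : -(4 * 10 ^ 5 * ε) ≤ y q := by
    have := mul_le_sub_of_le_deriv (p := p) (q := q) (C := -(3 / 2)) (by linarith)
      (fun x hx => hy.hasDerivAt x ⟨by linarith [hx.1], by linarith [hx.2]⟩) (fun x hx => by
        have h3 := hy.abs_mul_le hψ ha hb1 hY x ⟨by linarith [hx.1], by linarith [hx.2]⟩
        have h4 := abs_forcing_le x (hψ.abs_le_one (y x / ε))
        linarith [(abs_le.1 h3).2, (abs_le.1 h4).2])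
    rw [cy.eq] at this
    linarith
  have hcosd : ∀ x : ℝ, HasDerivAt (fun x => 2 / π * cos (π * x / 2)) (-sin (π * x / 2)) x := by
    intro x
    have h1 : HasDerivAt (fun x : ℝ => π * x / 2) (π / 2) x := by
      simpa using ((hasDerivAt_id x).const_mul π).div_const 2
    refine (h1.cos.const_mul (2 / π)).congr_deriv ?_
    field_simp
  have sy := mul_le_sub_of_le_deriv (p := q) (q := 2) (C := 0) (by linarith)
    (fun x hx => (hy.hasDerivAt x ⟨by linarith [hx.1], hx.2⟩).sub (hcosd x)) (fun x hx => by
      have h1 := cy.below x ⟨by linarith [hx.1], hx.2⟩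
      rw [hψ.apply_div_of_le_neg hε h1, forcing_neg_one]
      nlinarith)
  have sw := sub_le_mul_of_deriv_le (p := q') (q := 2) (C := 0) (by linarith)
    (fun x hx => (hw.hasDerivAt x ⟨by linarith [hx.1], hx.2⟩).sub (hcosd x)) (fun x hx => by
      have h1 := cw.below x ⟨by linarith [hx.1], hx.2⟩
      rw [hψ.apply_div_of_le_neg hε h1, forcing_neg_one]
      nlinarith)
  have sc := sub_le_mul_of_deriv_le (p := q') (q := q) (C := -(1 / 2)) (by linarith)
    (fun x _ => hcosd x) (fun x hx => by
      have := half_le_sin (x := x) (by linarith [hx.1]) (by linarith [hx.2])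
      linarith)
  have hwq := cw.below q' ⟨le_rfl, by linarith⟩
  simp only [Pi.sub_apply] at sy sw
  nlinarith

theorem log_crossing_sub_le {p p' d : ℝ} (hp : p ∈ Icc (1 / 3) (2 / 3 - 1 / 10 ^ 5))
    (hp' : p' ∈ Icc (1 / 3) (2 / 3 - 1 / 10 ^ 5)) (hd : 0 ≤ d) (h : p - p' ≤ d) :
    log (1 + 2 * cos (π * p')) - log (1 + 2 * cos (π * p)) ≤ 7 / (3 / 10 ^ 5) * d := by
  have hlow : ∀ x ∈ Icc (1 / 3 : ℝ) (2 / 3 - 1 / 10 ^ 5), 3 / 10 ^ 5 ≤ 1 + 2 * cos (π * x) := by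
    intro x hx
    have := le_one_add_mul_cos (u := 1) (by simp) hx.1 hx.2
    linarith
  have hdv : ∀ x ∈ Icc (1 / 3 : ℝ) (2 / 3 - 1 / 10 ^ 5),
      HasDerivAt (fun x => log (1 + 2 * cos (π * x)))
        (2 * -(π * sin (π * x)) / (1 + 2 * cos (π * x))) x := by
    intro x hx
    have : 0 < 1 + 2 * cos (π * x) := lt_of_lt_of_le (by norm_num) (hlow x hx)
    exact (((hasDerivAt_cos_pi x).const_mul 2).const_add 1).log this.ne'
  rcases le_total p p' with hle | hle
  · have := sub_le_mul_of_deriv_le (C := 0) hle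
      (fun x hx => hdv x ⟨hp.1.trans hx.1, hx.2.trans hp'.2⟩) (fun x hx => by
        have h1 := hlow x ⟨hp.1.trans hx.1, hx.2.trans hp'.2⟩
        apply div_nonpos_of_nonpos_of_nonneg _ (le_trans (by norm_num) h1)
        have : 0 ≤ sin (π * x) := sin_nonneg_of_nonneg_of_le_pi
          (by nlinarith [pi_pos, hp.1, hx.1]) (by nlinarith [pi_pos, hp'.2, hx.2])
        nlinarith [mul_nonneg pi_pos.le this])
    have h7 : 0 ≤ 7 / (3 / 10 ^ 5) * d := by positivity
    linarith
  · have := mul_le_sub_of_le_deriv (C := -(7 / (3 / 10 ^ 5))) hle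
      (fun x hx => hdv x ⟨hp'.1.trans hx.1, hx.2.trans hp.2⟩) (fun x hx => by
        have h1 := hlow x ⟨hp'.1.trans hx.1, hx.2.trans hp.2⟩
        have h2 := (abs_le.1 (abs_pi_mul_sin_le (π * x))).2
        rw [le_div_iff₀ (lt_of_lt_of_le (by norm_num) h1)]
        rw [div_le_iff₀ (by norm_num)] at h1
        linarith)
    have h7 : 7 / (3 / 10 ^ 5) * (p - p') ≤ 7 / (3 / 10 ^ 5) * d := by gcongr
    linarith

theorem IsTransition.abs_taylor_le {ψ : ℝ → ℝ} {M : ℝ} (hψ : IsTransition ψ M) {η ρ : ℝ}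
    (h : ∀ u w, |u - w| < ρ → |deriv ψ u - deriv ψ w| ≤ η) {u w : ℝ} (huw : |u - w| < ρ) :
    |ψ u - ψ w - deriv ψ w * (u - w)| ≤ η * |u - w| := by
  have hρ : 0 < ρ := (abs_nonneg _).trans_lt huw
  have := (convex_ball w ρ).norm_image_sub_le_of_norm_hasDerivWithin_le
    (f := fun t => ψ t - deriv ψ w * t) (f' := fun t => deriv ψ t - deriv ψ w)
    (x := w) (y := u) (C := η)
    (fun t _ => by
      simpa using ((hψ.hasDerivAt t).fun_sub
        ((hasDerivAt_id t).const_mul (deriv ψ w))).hasDerivWithinAt)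
    (fun t ht => h t w (by simpa [Real.dist_eq] using ht)) (by simpa using hρ)
    (by simpa [Real.dist_eq] using huw)
  simp only [Real.norm_eq_abs] at this
  convert this using 2
  ring

/-- A periodic solution along which the transversal derivative has negative mean attracts every
solution that starts close to it. -/
theorem tendsto_of_contracting {ψ : ℝ → ℝ} {M a ε κ : ℝ} {vp Φ : ℝ → ℝ}
    (hψ : IsTransition ψ M) (hε : 0 < ε) (hκ : 0 < κ)
    (hvp : ∀ x, HasDerivAt vp ((-(a * ε * vp x) - forcing x (ψ (vp x))) / ε) x)
    (hΦ : ∀ x, HasDerivAt Φ (-a - cos (π * x) * sin (π * x / 2) * deriv ψ (vp x) / ε) x)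
    (hΦκ : ∀ x, Φ (x + 4) = Φ x - κ) :
    ∃ δ : ℝ, 0 < δ ∧ ∀ (v : ℝ → ℝ) (x₀ : ℝ),
      (∀ x, x₀ ≤ x → HasDerivAt v ((-(a * ε * v x) - forcing x (ψ (v x))) / ε) x) →
      |v x₀ - vp x₀| < δ → Filter.Tendsto (fun x => |v x - vp x|) Filter.atTop (nhds 0) := by
  obtain ⟨C, hC⟩ : ∃ C, ∀ x, |Φ x + κ / 4 * x| ≤ C := by
    have hp : Function.Periodic (fun x => Φ x + κ / 4 * x) 4 := fun x => by
      simp only [hΦκ]; ring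
    have hc : Continuous fun x => Φ x + κ / 4 * x :=
      (continuous_iff_continuousAt.2 fun x => (hΦ x).continuousAt).add (by fun_prop)
    obtain ⟨C, hC⟩ := isBounded_iff_forall_norm_le.1
      (hp.isBounded_of_continuous (by norm_num) hc)
    exact ⟨C, fun x => hC _ ⟨x, rfl⟩⟩
  obtain ⟨ρ, hρ, hmod⟩ := Metric.uniformContinuous_iff.1 hψ.uniformContinuous_deriv
    (κ * ε / 16) (by positivity)
  have htaylor : ∀ {u w : ℝ}, |u - w| < ρ →
      |ψ u - ψ w - deriv ψ w * (u - w)| ≤ κ * ε / 16 * |u - w| := fun huw =>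
    hψ.abs_taylor_le (fun u w h => (hmod h).le) huw
  refine ⟨ρ / 2 * exp (-(2 * C)), by positivity, fun v x₀ hv h0 => ?_⟩
  set s := ρ / 2 * exp (-(2 * C)) with hs
  have hs0 : 0 < s := by positivity
  set E : ℝ → ℝ := fun x => Φ x - Φ x₀ + κ / 8 * (x - x₀) with hE
  have hEle : ∀ x, E x ≤ 2 * C - κ / 8 * (x - x₀) := fun x => by
    have h1 := (abs_le.1 (hC x)).2
    have h2 := (abs_le.1 (hC x₀)).1
    simp only [hE]
    linarith
  have hsE : ∀ x, s * exp (E x) ≤ ρ / 2 * exp (-(κ / 8 * (x - x₀))) := fun x => by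
    rw [hs, mul_assoc, ← exp_add]
    gcongr
    linarith [hEle x]
  have hEd : ∀ x, HasDerivAt E
      (-a - cos (π * x) * sin (π * x / 2) * deriv ψ (vp x) / ε + κ / 8) x := fun x => by
    simpa using ((hΦ x).sub_const (Φ x₀)).fun_add
      (((hasDerivAt_id x).sub_const x₀).const_mul (κ / 8))
  have hle : ∀ x, x₀ ≤ x → |v x - vp x| ≤ s * exp (E x) := by
    intro x hx
    refine abs_le_of_sq_le_sq ?_ (by positivity)
    refine le_of_deriv_lt_of_eq (p := x₀) (q := x) (f := fun x => (v x - vp x) ^ 2)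
      (B := fun x => (s * exp (E x)) ^ 2)
      (fun t ht => ((hv t ht.1).sub (hvp t)).pow 2)
      (fun t _ => ((hEd t).exp.const_mul s).pow 2) ?_ (fun t ht he => ?_) x ⟨hx, le_rfl⟩
    · simp only [hE, sub_self, mul_zero, add_zero, exp_zero, mul_one]
      exact sq_le_sq' (by linarith [(abs_lt.1 h0).1]) (abs_lt.1 h0).2.le
    · have hpos : 0 < s * exp (E t) := by positivity
      have habs : |v t - vp t| = s * exp (E t) := by
        rw [← abs_of_pos hpos]; exact (sq_eq_sq_iff_abs_eq_abs _ _).1 he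
      have hlt : |v t - vp t| < ρ := by
        rw [habs]
        refine (hsE t).trans_lt ?_
        have : exp (-(κ / 8 * (t - x₀))) ≤ 1 := exp_le_one_iff.2 (by
          have := ht.1
          have : 0 ≤ κ / 8 * (t - x₀) := mul_nonneg (by positivity) (by linarith)
          linarith)
        nlinarith
      have hr := htaylor hlt
      have hcs := abs_cos_mul_sin_le (π * t) (π * t / 2)
      have hdr : -((v t - vp t) * (cos (π * t) * sin (π * t / 2) *
          (ψ (v t) - ψ (vp t) - deriv ψ (vp t) * (v t - vp t)))) / ε
          ≤ κ / 16 * (v t - vp t) ^ 2 := by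
        rw [div_le_iff₀ hε]
        refine (neg_le_abs _).trans ?_
        rw [abs_mul, abs_mul, ← sq_abs (v t - vp t)]
        calc _ ≤ |v t - vp t| * (1 * (κ * ε / 16 * |v t - vp t|)) := by gcongr
          _ = _ := by ring
      have hsub := forcing_sub t (ψ (v t)) (ψ (vp t))
      have hQ : 0 < κ * (s * exp (E t)) ^ 2 := by positivity
      calc _ = 2 * (-a - cos (π * t) * sin (π * t / 2) * deriv ψ (vp t) / ε) *
              (v t - vp t) ^ 2 + 2 * (-((v t - vp t) * (cos (π * t) * sin (π * t / 2) *
            (ψ (v t) - ψ (vp t) - deriv ψ (vp t) * (v t - vp t)))) / ε) := by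
            rw [← sub_div, show -(a * ε * v t) - forcing t (ψ (v t)) -
              (-(a * ε * vp t) - forcing t (ψ (vp t))) = -(a * ε * (v t - vp t)) -
              (forcing t (ψ (v t)) - forcing t (ψ (vp t))) by ring, hsub]
            simp only [Pi.sub_apply]
            push_cast
            field_simp
            ring
        _ < _ := by
            rw [he] at hdr ⊢
            push_cast
            linarith
  refine squeeze_zero' (Filter.Eventually.of_forall fun x => abs_nonneg _)
    ((Filter.eventually_ge_atTop x₀).mono fun x hx => (hle x hx).trans (hsE x)) ?_
  have : Filter.Tendsto (fun x => -(κ / 8 * (x - x₀))) Filter.atTop Filter.atBot := by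
    rw [Filter.tendsto_neg_atBot_iff]
    exact (Filter.tendsto_atTop_add_const_right _ _ Filter.tendsto_id).const_mul_atTop
      (by positivity)
  simpa using (tendsto_exp_atBot.comp this).const_mul (ρ / 2)

/-- Along a 4-periodic solution made of two half solutions the logarithm `Φ` of the transversal
derivative decreases over a period. -/
theorem gain_lt {ψ : ℝ → ℝ} {M a ε Y p p' : ℝ} {y w vp Φ : ℝ → ℝ}
    (hψ : IsTransition ψ M) (ha0 : 0 < a) (ha : a ≤ 1 / 10 ^ 11) (hε : 0 < ε)
    (hεM : (2 * (M + 7) / (3 / 10 ^ 5) * (2 * 10 ^ 5) + 7 / (3 / 10 ^ 5) * (8 * 10 ^ 5)) * ε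
      < 4 * a)
    (hY : |Y| ≤ 1) (hy : HalfSol ψ a ε Y y) (hw : HalfSol ψ (-a) ε Y w) (h2 : y 2 = w 2)
    (cy : CrossesAt ε p y) (cw : CrossesAt ε p' w) (hp : 1 / 3 ≤ p) (hp' : 1 / 3 ≤ p')
    (hq : p + 2 * 10 ^ 5 * ε ≤ 2 / 3 - 1 / 10 ^ 5) (hq' : p' + 2 * 10 ^ 5 * ε ≤ 2 / 3 - 1 / 10 ^ 5)
    (hvy : ∀ x ∈ Icc (0 : ℝ) 2, vp x = y x / ε) (hvw : ∀ x ∈ Icc (0 : ℝ) 2, vp (-x) = w x / ε)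
    (hΦ : ∀ x, HasDerivAt Φ (-a - cos (π * x) * sin (π * x / 2) * deriv ψ (vp x) / ε) x) :
    Φ 2 < Φ (-2) := by
  have hb1 : |a| ≤ 1 := by rw [abs_of_pos ha0]; linarith
  have hb2 : |-a| ≤ 1 := by rwa [abs_neg]
  have gy := hy.abs_gain_sub_log_le (G := fun x => -(a * x) - Φ x) hψ hb1 hε cy hp hq
    (fun x hx => by
      refine (((hasDerivAt_id x).const_mul a).neg.sub (hΦ x)).congr_deriv ?_
      rw [hvy x hx]
      ring)
  have gw := hw.abs_gain_sub_log_le (G := fun x => a * x - Φ (-x)) hψ hb2 hε cw hp' hq'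
    (fun x hx => by
      have h1 : HasDerivAt (fun x => Φ (-x)) _ x := (hΦ (-x)).comp x (hasDerivAt_neg x)
      refine (((hasDerivAt_id x).const_mul a).sub h1).congr_deriv ?_
      rw [hvw x hx, show π * -x = -(π * x) by ring, cos_neg,
        show -(π * x) / 2 = -(π * x / 2) by ring, sin_neg]
      ring)
  have hd := cy.sub_le cw hψ ha0 ha hε hY hy hw h2 (by linarith) hp'
  have hl := log_crossing_sub_le (p := p) (p' := p') ⟨hp, by linarith⟩ ⟨hp', by linarith⟩
    (by positivity) hd
  simp only [mul_zero, neg_zero] at gy gw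
  have := (abs_le.1 gy).1
  have := (abs_le.1 gw).2
  have : (2 * (M + 7) / (3 / 10 ^ 5) * (2 * 10 ^ 5) + 7 / (3 / 10 ^ 5) * (8 * 10 ^ 5)) * ε
    = 2 * ((M + 7) / (3 / 10 ^ 5) * (2 * 10 ^ 5 * ε)) + 7 / (3 / 10 ^ 5) * (8 * 10 ^ 5 * ε) := by
    ring
  linarith

theorem exists_periodic_halfSol {ψ : ℝ → ℝ} {M a ε : ℝ} (hψ : IsTransition ψ M) (ha0 : 0 < a)
    (ha : a ≤ 1 / 10 ^ 11) (hε : 0 < ε) (hεa : 4000 * ε ≤ a) :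
    ∃ c ∈ Icc (1 / π) (-arch (2 / 3 - 2 / 10 ^ 5)), ∃ y : ℝ → ℝ,
      (∀ x ∈ Icc (-2 : ℝ) 2, HasDerivAt y (-(a * y x) - forcing x (ψ (y x / ε))) x) ∧
      y (-2) = y 2 ∧ HalfSol ψ a ε c y ∧ HalfSol ψ (-a) ε c (fun x => y (-x)) := by
  obtain ⟨Y, hY, hYc⟩ := exists_flow hψ ha0.le (ha.trans (by norm_num)) hε
  set Y₁ := -arch (2 / 3 - 2 / 10 ^ 5) with hY₁
  have hle : 1 / π ≤ Y₁ := one_div_pi_le_neg_arch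
  have hY₁1 : Y₁ ≤ 1 := neg_arch_le_one _
  have hpi : 0 < 1 / π := by positivity
  have hsub : Icc (1 / π) Y₁ ⊆ Icc (-1) 1 := Icc_subset_Icc (by linarith) hY₁1
  have fwd : ∀ c ∈ Icc (1 / π) Y₁, HalfSol ψ a ε c (Y c) := fun c hc =>
    ⟨(hY c (hsub hc)).1, fun x hx => (hY c (hsub hc)).2 x ⟨by linarith [hx.1], hx.2⟩⟩
  have bwd : ∀ c ∈ Icc (1 / π) Y₁, HalfSol ψ (-a) ε c (fun x => Y c (-x)) := fun c hc =>
    ⟨by simpa using (hY c (hsub hc)).1, fun x hx => by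
      have h1 := ((hY c (hsub hc)).2 (-x) ⟨by linarith [hx.2], by linarith [hx.1]⟩).comp x
        (hasDerivAt_neg x)
      refine h1.congr_deriv ?_
      rw [forcing_neg]
      ring⟩
  have hcont : ContinuousOn (fun c => Y c 2 - Y c (-2)) (Icc (1 / π) Y₁) :=
    ((hYc 2 (by norm_num)).sub (hYc (-2) (by norm_num))).mono hsub
  have hl := shooting_low hψ ha0 ha hε hεa (fwd _ ⟨le_rfl, hle⟩) (bwd _ ⟨le_rfl, hle⟩)
  have hh := shooting_high hψ ha0 ha hε hεa hY₁ (fwd _ ⟨hle, le_rfl⟩) (bwd _ ⟨hle, le_rfl⟩)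
  obtain ⟨c, hc, hc0⟩ := intermediate_value_Icc' hle hcont
    (show (0 : ℝ) ∈ Icc _ _ from ⟨by linarith, by linarith⟩)
  exact ⟨c, hc, Y c, (hY c (hsub hc)).2, by simp only at hc0; linarith, fwd c hc, bwd c hc⟩

theorem HalfSol.exists_crossesAt_of_le {ψ : ℝ → ℝ} {M a b ε c : ℝ} {y : ℝ → ℝ}
    (h : HalfSol ψ b ε c y) (hψ : IsTransition ψ M) (ha0 : 0 < a) (ha : a ≤ 1 / 10 ^ 11)
    (hb : |b| ≤ a) (hε : 0 < ε) (hεa : 4000 * ε ≤ a)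
    (hc : c ∈ Icc (1 / π) (-arch (2 / 3 - 2 / 10 ^ 5))) :
    ∃ p, CrossesAt ε p y ∧ 1 / 3 ≤ p ∧ p + 2 * 10 ^ 5 * ε ≤ 2 / 3 - 1 / 10 ^ 5 := by
  have hneg : c + arch (2 / 3 - 3 / 2 / 10 ^ 5) + 6 * a < ε := by
    have := arch_sub_ge (x := 2 / 3 - 2 / 10 ^ 5) (z := 2 / 3 - 3 / 2 / 10 ^ 5) (by norm_num)
      (by norm_num) (by norm_num)
    have := hc.2
    norm_num at *
    linarith
  have hc1 : |c| ≤ 1 := by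
    rw [abs_of_nonneg (le_trans (by positivity) hc.1)]
    exact hc.2.trans (neg_arch_le_one _)
  obtain ⟨p, hp, cp⟩ := h.exists_crossesAt hψ ha0 ha hb hε (by linarith) hc1 hc.1
    (x₁ := 2 / 3 - 3 / 2 / 10 ^ 5) (by norm_num) (by norm_num; linarith) hneg
  exact ⟨p, cp, hp.1, by linarith [hp.2]⟩

theorem exists_periodic_orbit {ψ : ℝ → ℝ} {M a ε : ℝ} (hψ : IsTransition ψ M) (ha0 : 0 < a)
    (ha : a ≤ 1 / 10 ^ 11) (hε : 0 < ε) (hεa : 4000 * ε ≤ a)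
    (hεM : (2 * (M + 7) / (3 / 10 ^ 5) * (2 * 10 ^ 5) + 7 / (3 / 10 ^ 5) * (8 * 10 ^ 5)) * ε
      < 4 * a) :
    ∃ vp : ℝ → ℝ,
      (∀ x, HasDerivAt vp ((-(a * ε * vp x) - forcing x (ψ (vp x))) / ε) x) ∧
      (∀ x, vp (x + 4) = vp x) ∧
      ∃ Φ : ℝ → ℝ, ∃ κ : ℝ, 0 < κ ∧
        (∀ x, HasDerivAt Φ (-a - cos (π * x) * sin (π * x / 2) * deriv ψ (vp x) / ε) x) ∧
        ∀ x, Φ (x + 4) = Φ x - κ := by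
  obtain ⟨c, hc, y, hy, hy2, hf, hb⟩ := exists_periodic_halfSol hψ ha0 ha hε hεa
  have hb1 : |a| ≤ a := (abs_of_pos ha0).le
  obtain ⟨p, cp, hp, hq⟩ := hf.exists_crossesAt_of_le hψ ha0 ha hb1 hε hεa hc
  obtain ⟨p', cp', hp', hq'⟩ := hb.exists_crossesAt_of_le hψ ha0 ha (by rwa [abs_neg]) hε hεa hc
  obtain ⟨vp, hvp, hper, hvy⟩ := exists_periodic_extension
    (F := fun x v => (-(a * ε * v) - forcing x (ψ v)) / ε) (y := fun x => y x / ε)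
    (fun x v => by simp only [forcing_add_four])
    (fun x hx => ((hy x hx).div_const ε).congr_deriv (by field_simp)) (by simp only [hy2])
  refine ⟨vp, hvp, hper, ?_⟩
  set A : ℝ → ℝ := fun x => -a - cos (π * x) * sin (π * x / 2) * deriv ψ (vp x) / ε with hA
  have hvc : Continuous vp := continuous_iff_continuousAt.2 fun x => (hvp x).continuousAt
  have hAc : Continuous A := by
    have := hψ.continuous_deriv.comp hvc
    simp only [hA]
    fun_prop
  have hAper : ∀ x, A (x + 4) = A x := by
    intro x
    have h1 : cos (π * (x + 4)) = cos (π * x) := by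
      rw [show π * (x + 4) = π * x + 2 * π + 2 * π by ring, cos_add_two_pi, cos_add_two_pi]
    have h2 : sin (π * (x + 4) / 2) = sin (π * x / 2) := by
      rw [show π * (x + 4) / 2 = π * x / 2 + 2 * π by ring, sin_add_two_pi]
    simp only [hA, h1, h2, hper]
  have hΦ : ∀ x, HasDerivAt (fun x => ∫ t in (0 : ℝ)..x, A t) (A x) x := fun x =>
    (hAc.integral_hasStrictDerivAt 0 x).hasDerivAt
  set Φ : ℝ → ℝ := fun x => ∫ t in (0 : ℝ)..x, A t
  have hlt : Φ 2 < Φ (-2) := by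
    refine gain_lt hψ ha0 ha hε hεM ?_ hf hb hy2.symm cp cp' hp hp' hq hq'
      (fun x hx => hvy x ⟨by linarith [hx.1], hx.2⟩)
      (fun x hx => hvy (-x) ⟨by linarith [hx.2], by linarith [hx.1]⟩) hΦ
    rw [abs_of_nonneg (le_trans (by positivity) hc.1)]
    exact hc.2.trans (neg_arch_le_one _)
  refine ⟨Φ, Φ (-2) - Φ 2, sub_pos.2 hlt, hΦ, fun x => ?_⟩
  have hd : ∀ x, HasDerivAt (fun x => Φ (x + 4) - Φ x) 0 x := fun x => by
    refine (((hΦ (x + 4)).comp_add_const x 4).sub (hΦ x)).congr_deriv ?_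
    rw [hAper, sub_self]
  have := is_const_of_deriv_eq_zero (fun x => (hd x).differentiableAt) (fun x => (hd x).deriv) x (-2)
  norm_num at this
  linarith

/-- persistence under regularization of the non-sliding
4-periodic orbit of the linear switching system. For a transition function
`ψ` (C¹, increasing on the layer, equal to `sign` outside), there is
`a_l > 0` such that for every `a ∈ (0, a_l)` there is `ε₀ > 0` such that for
every `ε ∈ (0, ε₀)` the regularized equation
`ε·v′ = −aεv − [1 + (1 + ψ(v))cos(πx)]·sin(πx/2)` has a 4-periodic solution
`v_p` which is locally asymptotically stable. -/
theorem regularized_linear_nonsliding_periodic_orbit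
    (ψ : ℝ → ℝ) (hψ : ContDiff ℝ 1 ψ)
    (hψ' : ∀ u : ℝ, |u| < 1 → 0 < deriv ψ u)
    (hψs : ∀ u : ℝ, 1 ≤ |u| → ψ u = Real.sign u) :
    ∃ al : ℝ, 0 < al ∧ ∀ a ∈ Set.Ioo (0 : ℝ) al,
      ∃ ε₀ : ℝ, 0 < ε₀ ∧ ∀ ε ∈ Set.Ioo (0 : ℝ) ε₀,
        ∃ vp : ℝ → ℝ,
          (∀ x : ℝ, HasDerivAt vp
            ((-(a * ε * vp x)
              - (1 + (1 + ψ (vp x)) * Real.cos (π * x)) * Real.sin (π * x / 2)) / ε) x) ∧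
          (∀ x : ℝ, vp (x + 4) = vp x) ∧
          ∃ δ : ℝ, 0 < δ ∧ ∀ (v : ℝ → ℝ) (x₀ : ℝ),
            (∀ x : ℝ, x₀ ≤ x → HasDerivAt v
              ((-(a * ε * v x)
                - (1 + (1 + ψ (v x)) * Real.cos (π * x)) * Real.sin (π * x / 2)) / ε) x) →
            |v x₀ - vp x₀| < δ →
            Filter.Tendsto (fun x => |v x - vp x|) Filter.atTop (nhds 0) := by
  obtain ⟨M, hM⟩ := exists_isTransition hψ hψ' hψs
  have hM0 := hM.bound_nonneg
  refine ⟨1 / 10 ^ 11, by positivity, fun a ha => ?_⟩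
  set C := 2 * (M + 7) / (3 / 10 ^ 5) * (2 * 10 ^ 5) + 7 / (3 / 10 ^ 5) * (8 * 10 ^ 5) with hC
  have hC0 : 0 < C := by positivity
  have ha0 := ha.1
  refine ⟨min (a / 4000) (a / C), by positivity, fun ε hε => ?_⟩
  have h1 : ε < a / 4000 := hε.2.trans_le (min_le_left _ _)
  have h2 : ε < a / C := hε.2.trans_le (min_le_right _ _)
  rw [lt_div_iff₀ hC0] at h2
  obtain ⟨vp, hvp, hper, Φ, κ, hκ, hΦ, hΦκ⟩ :=
    exists_periodic_orbit hM ha0 ha.2.le hε.1 (by linarith) (by rw [← hC]; linarith)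
  exact ⟨vp, hvp, hper, tendsto_of_contracting hM hε.1 hκ hvp hΦ hΦκ⟩
end

section
/- For every a > 0 and every ε > 0, the regularized nonlinear switching equation ε·v′(x) = −a·ε·v(x) − sin(πx·(1 + ψ(v(x))/2)) has no periodic solution: there is no T > 0 and no solution v : ℝ → ℝ with v(x + T) = v(x) for all x ∈ ℝ. -/
open Real Set

lemma sin_eq_zero_of_sin_add_eq_of_sin_sub_eq {α β : ℝ}
    (h₁ : Real.sin (α + β) = Real.sin α) (h₂ : Real.sin (α - β) = Real.sin α) :
    Real.sin β = 0 := by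
  rw [Real.sin_add] at h₁
  rw [Real.sin_sub] at h₂
  have h₃ : Real.sin α * (Real.cos β - 1) = 0 := by linarith
  have h₄ : Real.cos α * Real.sin β = 0 := by linarith
  have hα := Real.sin_sq_add_cos_sq α
  have hβ := Real.sin_sq_add_cos_sq β
  rcases mul_eq_zero.mp h₃ with h | h
  · rcases mul_eq_zero.mp h₄ with h' | h'
    · rw [h, h'] at hα
      norm_num at hα
    · exact h'
  · have hcos : Real.cos β = 1 := by linarith
    rw [hcos] at hβ
    exact pow_eq_zero_iff two_ne_zero |>.mp (by linarith)

lemma Continuous.eq_of_forall_exists_intCast {X : Type*} [TopologicalSpace X]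
    [PreconnectedSpace X] {f : X → ℝ} (hf : Continuous f) (h : ∀ x, ∃ n : ℤ, (n : ℝ) = f x)
    (x y : X) : f x = f y := by
  choose n hn using h
  have hn' : (fun k : ℤ => (k : ℝ)) ∘ n = f := funext hn
  have hc : Continuous n := by
    rw [Int.isClosedEmbedding_coe_real.isInducing.continuous_iff]
    exact hn' ▸ hf
  rw [← hn x, ← hn y, PreconnectedSpace.constant ‹_› hc]

/-- A linear damped equation with sinusoidal forcing has no global solution bounded below by `1`. -/
lemma not_forall_one_le_of_hasDerivAt_sinusoid {v : ℝ → ℝ} {a b θ : ℝ} (ha : 0 < a) (hθ : θ ≠ 0)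
    (hv : ∀ x, HasDerivAt v (-(a * v x) - b * Real.sin (θ * x)) x) : ¬ ∀ x, 1 ≤ v x := by
  intro h
  set w : ℝ → ℝ := fun x => v x - b / θ * Real.cos (θ * x) + a * x
  have hw : ∀ x, HasDerivAt w (a - a * v x) x := by
    intro x
    have hlin : HasDerivAt (fun x : ℝ => θ * x) θ x := by
      simpa using (hasDerivAt_id x).const_mul θ
    have hax : HasDerivAt (fun x : ℝ => a * x) a x := by
      simpa using (hasDerivAt_id x).const_mul a
    refine (((hv x).sub (hlin.cos.const_mul (b / θ))).add hax).congr_deriv ?_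
    field_simp
    ring
  have hanti : Antitone w := antitone_of_deriv_nonpos (fun x => (hw x).differentiableAt) fun x => by
    rw [(hw x).deriv]
    nlinarith [h x]
  have hbound : ∀ x, b / θ * Real.cos (θ * x) ≤ |b / θ| := fun x =>
    (le_abs_self _).trans <| by
      rw [abs_mul]
      exact mul_le_of_le_one_right (abs_nonneg _) (Real.abs_cos_le_one _)
  set M := |w 0| + |b / θ|
  have hM : 0 ≤ M := by positivity
  have hle : w (M / a) ≤ w 0 := hanti (by positivity)
  have heq : w (M / a) = v (M / a) - b / θ * Real.cos (θ * (M / a)) + M := by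
    simp only [w]
    field_simp
  have hM' : M = |w 0| + |b / θ| := rfl
  linarith [h (M / a), hbound (M / a), le_abs_self (w 0)]

/-- the regularized nonlinear switching equation
`ε·v′ = −aεv − sin(πx(1 + ψ(v)/2))` has no periodic solution, for any
`a > 0`, `ε > 0` and any transition function `ψ`. -/
theorem regularized_nonlinear_no_periodic_solution
    (ψ : ℝ → ℝ) (hψ : ContDiff ℝ 1 ψ)
    (hψ' : ∀ u : ℝ, |u| < 1 → 0 < deriv ψ u)
    (hψs : ∀ u : ℝ, 1 ≤ |u| → ψ u = Real.sign u)
    (a ε : ℝ) (ha : 0 < a) (hε : 0 < ε) :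
    ¬ ∃ (T : ℝ) (v : ℝ → ℝ), 0 < T ∧
      (∀ x : ℝ, HasDerivAt v
        ((-(a * ε * v x) - Real.sin (π * x * (1 + ψ (v x) / 2))) / ε) x) ∧
      (∀ x : ℝ, v (x + T) = v x) := by
  rintro ⟨T, v, hT, hv, hper⟩
  have hvc : Continuous v := continuous_iff_continuousAt.mpr fun x => (hv x).continuousAt
  have hshift : ∀ x, Real.sin (π * (x + T) * (1 + ψ (v x) / 2)) =
      Real.sin (π * x * (1 + ψ (v x) / 2)) := by
    intro x
    have h₁ := (hv (x + T)).comp_add_const x T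
    rw [show (fun y => v (y + T)) = v from funext hper] at h₁
    have h₂ := h₁.unique (hv x)
    rw [hper, div_left_inj' hε.ne'] at h₂
    linarith
  have hsin : ∀ x, Real.sin (π * T * (1 + ψ (v x) / 2)) = 0 := by
    intro x
    have hback : v (x - T) = v x := by simpa using (hper (x - T)).symm
    have h := hshift (x - T)
    rw [hback, sub_add_cancel] at h
    apply sin_eq_zero_of_sin_add_eq_of_sin_sub_eq (α := π * x * (1 + ψ (v x) / 2))
    · rw [← hshift x]; ring_nf
    · rw [h]; ring_nf
  have hconst : ∀ x, ψ (v x) = ψ (v 0) := by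
    intro x
    have hc : Continuous fun x => T * (1 + ψ (v x) / 2) := by
      have := hψ.continuous.comp hvc
      exact continuous_const.mul (continuous_const.add (this.div_const 2))
    have h := hc.eq_of_forall_exists_intCast (fun y => by
      obtain ⟨n, hn⟩ := Real.sin_eq_zero_iff.mp (hsin y)
      exact ⟨n, mul_right_cancel₀ Real.pi_ne_zero (by rw [hn]; ring)⟩) x 0
    have := mul_left_cancel₀ hT.ne' h
    linarith
  have hlin : ∀ x, HasDerivAt v
      (-(a * v x) - ε⁻¹ * Real.sin (π * (1 + ψ (v 0) / 2) * x)) x := by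
    intro x
    refine (hv x).congr_deriv ?_
    rw [hconst x, show π * (1 + ψ (v 0) / 2) * x = π * x * (1 + ψ (v 0) / 2) by ring]
    field_simp
  have hmono : StrictMonoOn ψ (Icc (-1) 1) :=
    strictMonoOn_of_deriv_pos (convex_Icc _ _) hψ.continuous.continuousOn fun u hu => by
      rw [interior_Icc] at hu
      exact hψ' u (abs_lt.mpr hu)
  have hge : ∀ u, 1 ≤ u → ψ u = 1 := fun u hu => by
    rw [hψs u (hu.trans (le_abs_self u)), Real.sign_of_pos (by linarith)]
  have hle : ∀ u, u ≤ -1 → ψ u = -1 := fun u hu => by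
    rw [hψs u (by linarith [neg_le_abs u]), Real.sign_of_neg (by linarith)]
  have hlt : ∀ u, u < 1 → ψ u < 1 := fun u hu => by
    rcases le_or_gt u (-1) with h | h
    · rw [hle u h]; norm_num
    · rw [← hge 1 le_rfl]
      exact hmono ⟨h.le, hu.le⟩ ⟨by norm_num, le_rfl⟩ hu
  have hgt : ∀ u, -1 < u → -1 < ψ u := fun u hu => by
    rcases le_or_gt 1 u with h | h
    · rw [hge u h]; norm_num
    · rw [← hle (-1) le_rfl]
      exact hmono ⟨le_rfl, by norm_num⟩ ⟨hu.le, h.le⟩ hu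
  have hθ : π * (1 + ψ (v 0) / 2) ≠ 0 := by
    have : -1 ≤ ψ (v 0) := by
      rcases le_or_gt (v 0) (-1) with h | h
      · exact (hle _ h).ge
      · exact (hgt _ h).le
    exact (mul_pos Real.pi_pos (by linarith)).ne'
  rcases le_or_gt 1 (v 0) with h1 | h1
  · refine not_forall_one_le_of_hasDerivAt_sinusoid ha hθ hlin fun x => ?_
    by_contra! h
    linarith [hlt _ h, hconst x, hge _ h1]
  rcases le_or_gt (v 0) (-1) with h2 | h2
  · refine not_forall_one_le_of_hasDerivAt_sinusoid (v := fun x => -v x) (b := -ε⁻¹) ha hθ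
      (fun x => ?_) fun x => ?_
    · refine (hlin x).neg.congr_deriv ?_
      ring
    · by_contra! h
      linarith [hgt (v x) (by linarith), hconst x, hle _ h2]
  have hvconst : ∀ x, v x = v 0 := by
    intro x
    have hx1 : v x < 1 := by
      by_contra! h
      linarith [hge _ h, hconst x, hlt _ h1]
    have hx2 : -1 < v x := by
      by_contra! h
      linarith [hle _ h, hconst x, hgt _ h2]
    exact hmono.injOn ⟨hx2.le, hx1.le⟩ ⟨h2.le, h1.le⟩ (hconst x)
  have hzero : ∀ x, -(a * v 0) - ε⁻¹ * Real.sin (π * (1 + ψ (v 0) / 2) * x) = 0 := by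
    intro x
    have h := hlin x
    rw [hvconst x, show v = fun _ => v 0 from funext hvconst] at h
    exact h.unique (hasDerivAt_const x _)
  have h₀ := hzero 0
  have h₁ := hzero (π / 2 / (π * (1 + ψ (v 0) / 2)))
  rw [mul_zero, Real.sin_zero] at h₀
  rw [mul_div_cancel₀ _ hθ, Real.sin_pi_div_two] at h₁
  have := inv_pos.mpr hε
  linarith
end
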